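/- arXiv:2401.05527 — 9 statements merged into one kernel-verified Lean document; each statement's English description precedes it below -/
import Mathlib

section
/- Let E ⊂ ℝⁿ be compact, let t ↦ Σ(t) be a continuous map from E to symmetric positive definite real d×d matrices which is uniformly positive definite on E, and let b ∈ ℝ^d have at least one positive component. For t ∈ E let b̃(t) denote the unique solution of Π_{Σ(t)}(b), set w(t) = Σ(t)⁻¹b̃(t), and define I(t) = {j : b̃(t)_j = b_j and w(t)_j > 0}, K(t) = {j : b̃(t)_j = b_j and w(t)_j = 0}, L(t) = {j : b̃(t)_j > b_j and w(t)_j = 0}, which partition {1,…,d}. Then: (i) E admits finite covers by pairwise disjoint locally closed sets on each of which I (respectively L, respectively K) is constant; (ii) the maps t ↦ I(t) and t ↦ L(t) are lower hemicontinuous; in particular, for every t ∈ E there exists ε(t) > 0 such that for all s ∈ E with |t − s| < ε(t) one has I(t) ⊆ I(s), L(t) ⊆ L(s), and consequently K(s) ⊆ K(t). -/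
open Matrix Set

open Filter Topology

/-- A set-valued map into subsets of a finite type which is lower hemicontinuous on a closed set `E`
splits `E` into finitely many disjoint locally closed pieces on which it is constant. -/
theorem exists_locallyClosed_cover_of_eventually_subset {X ι : Type*} [TopologicalSpace X]
    [Finite ι] {E : Set X} (hE : IsClosed E) (J : X → Set ι)
    (hJ : ∀ t ∈ E, ∀ᶠ s in 𝓝[E] t, J t ⊆ J s) :
    ∃ (m : ℕ) (A : Fin m → Set X),
      (∀ k, IsLocallyClosed (A k)) ∧ Pairwise (Function.onFun Disjoint A) ∧
      E ⊆ ⋃ k, A k ∧ ∀ k, ∀ t ∈ A k ∩ E, ∀ s ∈ A k ∩ E, J t = J s := by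
  classical
  obtain ⟨m, ⟨e⟩⟩ := Finite.exists_equiv_fin (Set ι)
  let O : ι → Set X := fun j => interior {s | s ∈ E → j ∈ J s}
  have hO : ∀ s ∈ E, ∀ j, s ∈ O j ↔ j ∈ J s := by
    intro s hs j
    refine ⟨fun h => interior_subset h hs, fun h => ?_⟩
    rw [mem_interior_iff_mem_nhds]
    filter_upwards [eventually_nhdsWithin_iff.1 (hJ s hs)] with r hr hrE using hr hrE h
  refine ⟨m, fun k => {s | s ∈ E ∧ J s = e.symm k}, fun k => ?_, ?_, ?_, ?_⟩
  · refine ⟨⋂ j ∈ e.symm k, O j, E ∩ ⋂ j ∈ (e.symm k)ᶜ, (O j)ᶜ, ?_, ?_, ?_⟩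
    · exact (Set.toFinite _).isOpen_biInter fun j _ => isOpen_interior
    · exact hE.inter (isClosed_biInter fun j _ => isOpen_interior.isClosed_compl)
    · ext s
      simp only [Set.mem_inter_iff, Set.mem_iInter, Set.mem_compl_iff, Set.mem_ofPred_eq]
      constructor
      · rintro ⟨hs, h⟩
        refine ⟨fun j hj => (hO s hs j).2 (h ▸ hj), hs, fun j hj hj' => hj ?_⟩
        exact h ▸ (hO s hs j).1 hj'
      · rintro ⟨h, hs, h'⟩
        refine ⟨hs, Set.ext fun j => ⟨fun hj => ?_, fun hj => (hO s hs j).1 (h j hj)⟩⟩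
        by_contra hj'
        exact h' j hj' ((hO s hs j).2 hj)
  · intro k l hkl
    refine Set.disjoint_left.2 ?_
    rintro s ⟨_, h⟩ ⟨_, h'⟩
    exact hkl (e.symm.injective (h.symm.trans h'))
  · intro s hs
    exact Set.mem_iUnion.2 ⟨e (J s), hs, by simp⟩
  · rintro k t ⟨⟨_, h⟩, _⟩ s ⟨⟨_, h'⟩, _⟩
    exact h.trans h'.symm

section QuadraticProgram

variable {ι : Type*} [Fintype ι]

/-- First-order optimality condition for minimizing a symmetric quadratic form over `x ≥ b`. -/
theorem dotProduct_mulVec_sub_nonneg_of_isMin {P : Matrix ι ι ℝ} (hP : Pᵀ = P) {b y x : ι → ℝ}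
    (hy : b ≤ y) (hmin : ∀ z, b ≤ z → y ⬝ᵥ (P *ᵥ y) ≤ z ⬝ᵥ (P *ᵥ z)) (hx : b ≤ x) :
    0 ≤ (P *ᵥ y) ⬝ᵥ (x - y) := by
  have key : ∀ ε : ℝ, 0 < ε → ε ≤ 1 →
      0 ≤ 2 * ((P *ᵥ y) ⬝ᵥ (x - y)) + ε * ((x - y) ⬝ᵥ (P *ᵥ (x - y))) := by
    intro ε hε hε1
    have hz : b ≤ y + ε • (x - y) := by
      intro j
      have h1 := hy j
      have h2 := hx j
      simp only [Pi.add_apply, Pi.smul_apply, Pi.sub_apply, smul_eq_mul]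
      nlinarith
    have h := hmin _ hz
    have hsymm : y ⬝ᵥ (P *ᵥ (x - y)) = (x - y) ⬝ᵥ (P *ᵥ y) := by
      rw [dotProduct_mulVec, ← mulVec_transpose, hP, dotProduct_comm]
    simp only [mulVec_add, mulVec_smul, dotProduct_add, add_dotProduct, smul_dotProduct,
      dotProduct_smul, smul_eq_mul, hsymm] at h
    rw [dotProduct_comm (P *ᵥ y)]
    refine nonneg_of_mul_nonneg_right (a := ε) ?_ hε
    linarith
  have hlim : Tendsto (fun ε : ℝ => 2 * ((P *ᵥ y) ⬝ᵥ (x - y)) +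
      ε * ((x - y) ⬝ᵥ (P *ᵥ (x - y)))) (𝓝[>] 0)
      (𝓝 (2 * ((P *ᵥ y) ⬝ᵥ (x - y)) + 0 * ((x - y) ⬝ᵥ (P *ᵥ (x - y))))) :=
    (Continuous.tendsto (by fun_prop) 0).mono_left nhdsWithin_le_nhds
  have h := ge_of_tendsto hlim (by
    filter_upwards [Ioc_mem_nhdsGT (zero_lt_one' ℝ)] with ε hε using key ε hε.1 hε.2)
  linarith

/-- Nonnegativity of the multipliers from the variational inequality. -/
theorem nonneg_of_forall_dotProduct_sub_nonneg {b y w : ι → ℝ} (hy : b ≤ y)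
    (h : ∀ x, b ≤ x → 0 ≤ w ⬝ᵥ (x - y)) (j : ι) : 0 ≤ w j := by
  classical
  simpa using h (y + Pi.single j 1)
    (hy.trans (le_add_of_nonneg_right (Pi.single_nonneg.2 zero_le_one)))

/-- Complementary slackness from the variational inequality. -/
theorem eq_zero_of_forall_dotProduct_sub_nonneg {b y w : ι → ℝ} (hy : b ≤ y)
    (h : ∀ x, b ≤ x → 0 ≤ w ⬝ᵥ (x - y)) {j : ι} (hj : b j < y j) : w j = 0 := by
  classical
  refine le_antisymm ?_ (nonneg_of_forall_dotProduct_sub_nonneg hy h j)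
  have hx : b ≤ y + Pi.single j (b j - y j) := by
    intro i
    rcases eq_or_ne i j with rfl | hij
    · simp
    · simpa [hij] using hy i
  have := h _ hx
  rw [add_sub_cancel_left, dotProduct_single] at this
  nlinarith

/-- Strong monotonicity estimate: the multipliers of two quadratic programs with the same
constraint differ by at most the perturbation of the matrix. -/
theorem sq_mul_sum_sq_sub_le {S T : Matrix ι ι ℝ} {m : ℝ} (hm : 0 < m)
    (hS : ∀ x : ι → ℝ, m * (∑ j, (x j) ^ 2) ≤ x ⬝ᵥ (S *ᵥ x)) {v w : ι → ℝ}
    (hv : 0 ≤ v ⬝ᵥ (T *ᵥ w - S *ᵥ v)) (hw : 0 ≤ w ⬝ᵥ (S *ᵥ v - T *ᵥ w)) :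
    m ^ 2 * ∑ j, (v j - w j) ^ 2 ≤ ∑ j, (((T - S) *ᵥ w) j) ^ 2 := by
  have h1 := hS (v - w)
  have h2 : (v - w) ⬝ᵥ (S *ᵥ (v - w)) ≤ (v - w) ⬝ᵥ ((T - S) *ᵥ w) := by
    simp only [mulVec_sub, sub_mulVec, dotProduct_sub, sub_dotProduct] at *
    linarith
  have h3 : 2 * m * ((v - w) ⬝ᵥ ((T - S) *ᵥ w)) ≤
      m ^ 2 * ∑ j, (v j - w j) ^ 2 + ∑ j, (((T - S) *ᵥ w) j) ^ 2 := by
    rw [dotProduct, Finset.mul_sum, Finset.mul_sum, ← Finset.sum_add_distrib]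
    refine Finset.sum_le_sum fun j _ => ?_
    simp only [Pi.sub_apply]
    nlinarith [sq_nonneg (m * (v j - w j) - ((T - S) *ᵥ w) j)]
  simp only [Pi.sub_apply] at h1
  nlinarith [mul_le_mul_of_nonneg_left (h1.trans h2) hm.le]

end QuadraticProgram

/-- Let `E ⊂ ℝⁿ` be compact, `t ↦ Σ(t)` a continuous, uniformly positive
definite family of symmetric positive definite `d×d` matrices on `E`, and `b ∈ ℝ^d` with a
positive component.  With `b̃(t)` the unique solution of the quadratic program `Π_{Σ(t)}(b)`,
`w(t) = Σ(t)⁻¹b̃(t)`, and the index sets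
`I(t) = {j : b̃(t)_j = b_j, w(t)_j > 0}`, `K(t) = {j : b̃(t)_j = b_j, w(t)_j = 0}`,
`L(t) = {j : b̃(t)_j > b_j, w(t)_j = 0}`:
(i) `E` admits finite covers by pairwise disjoint locally closed sets on which `I`
(resp. `L`, resp. `K`) is constant; and
(ii) for every `t ∈ E` there is `ε(t) > 0` such that `|t − s| < ε(t)`, `s ∈ E`, implies
`I(t) ⊆ I(s)`, `L(t) ⊆ L(s)` and `K(s) ⊆ K(t)`. -/
theorem stmt_1 {n d : ℕ} (hd : 1 ≤ d)
    (E : Set (Fin n → ℝ)) (hE : IsCompact E)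
    (Sig : (Fin n → ℝ) → Matrix (Fin d) (Fin d) ℝ)
    (hcont : ContinuousOn Sig E)
    (hpd : ∀ t ∈ E, (Sig t).PosDef)
    (hunif : ∃ m > (0 : ℝ), ∀ t ∈ E, ∀ x : Fin d → ℝ,
      m * (∑ j, (x j) ^ 2) ≤ x ⬝ᵥ (Sig t *ᵥ x))
    (b : Fin d → ℝ) (hb : ∃ j, 0 < b j)
    (btil : (Fin n → ℝ) → (Fin d → ℝ))
    (hfeas : ∀ t ∈ E, b ≤ btil t)
    (hmin : ∀ t ∈ E, ∀ x : Fin d → ℝ, b ≤ x →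
      btil t ⬝ᵥ ((Sig t)⁻¹ *ᵥ btil t) ≤ x ⬝ᵥ ((Sig t)⁻¹ *ᵥ x))
    (huniq : ∀ t ∈ E, ∀ x : Fin d → ℝ, b ≤ x →
      x ⬝ᵥ ((Sig t)⁻¹ *ᵥ x) = btil t ⬝ᵥ ((Sig t)⁻¹ *ᵥ btil t) → x = btil t)
    (I K L : (Fin n → ℝ) → Set (Fin d))
    (hI : ∀ t, I t = {j | btil t j = b j ∧ 0 < ((Sig t)⁻¹ *ᵥ btil t) j})
    (hK : ∀ t, K t = {j | btil t j = b j ∧ ((Sig t)⁻¹ *ᵥ btil t) j = 0})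
    (hL : ∀ t, L t = {j | b j < btil t j ∧ ((Sig t)⁻¹ *ᵥ btil t) j = 0}) :
    ((∃ (m : ℕ) (A : Fin m → Set (Fin n → ℝ)),
        (∀ k, IsLocallyClosed (A k)) ∧ Pairwise (Function.onFun Disjoint A) ∧
        E ⊆ ⋃ k, A k ∧ ∀ k, ∀ t ∈ A k ∩ E, ∀ s ∈ A k ∩ E, I t = I s) ∧
      (∃ (m : ℕ) (A : Fin m → Set (Fin n → ℝ)),
        (∀ k, IsLocallyClosed (A k)) ∧ Pairwise (Function.onFun Disjoint A) ∧
        E ⊆ ⋃ k, A k ∧ ∀ k, ∀ t ∈ A k ∩ E, ∀ s ∈ A k ∩ E, L t = L s) ∧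
      (∃ (m : ℕ) (A : Fin m → Set (Fin n → ℝ)),
        (∀ k, IsLocallyClosed (A k)) ∧ Pairwise (Function.onFun Disjoint A) ∧
        E ⊆ ⋃ k, A k ∧ ∀ k, ∀ t ∈ A k ∩ E, ∀ s ∈ A k ∩ E, K t = K s)) ∧
    ∀ t ∈ E, ∃ ε > (0 : ℝ), ∀ s ∈ E, dist s t < ε →
      I t ⊆ I s ∧ L t ⊆ L s ∧ K s ⊆ K t := by
  obtain ⟨m, hm, hunif⟩ := hunif
  set w : (Fin n → ℝ) → Fin d → ℝ := fun t => (Sig t)⁻¹ *ᵥ btil t with hw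
  have hSw : ∀ t ∈ E, Sig t *ᵥ w t = btil t := fun t ht => by
    rw [hw, mulVec_mulVec, mul_nonsing_inv _ ((isUnit_iff_isUnit_det _).1 (hpd t ht).isUnit),
      one_mulVec]
  have hvar : ∀ t ∈ E, ∀ x, b ≤ x → 0 ≤ w t ⬝ᵥ (x - btil t) := fun t ht x hx =>
    dotProduct_mulVec_sub_nonneg_of_isMin (by simpa using (hpd t ht).isHermitian.inv.eq)
      (hfeas t ht) (hmin t ht) hx
  have hnonneg : ∀ t ∈ E, ∀ j, 0 ≤ w t j := fun t ht =>
    nonneg_of_forall_dotProduct_sub_nonneg (hfeas t ht) (hvar t ht)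
  have hslack : ∀ t ∈ E, ∀ j, b j < btil t j → w t j = 0 := fun t ht j =>
    eq_zero_of_forall_dotProduct_sub_nonneg (hfeas t ht) (hvar t ht)
  have hwcont : ContinuousOn w E := by
    intro t ht
    have hS : Tendsto Sig (𝓝[E] t) (𝓝 (Sig t)) := hcont t ht
    have hbound : Tendsto (fun s => (∑ j, (((Sig t - Sig s) *ᵥ w t) j) ^ 2) / m ^ 2)
        (𝓝[E] t) (𝓝 0) := by
      have hF : Continuous fun S : Matrix (Fin d) (Fin d) ℝ =>
          (∑ j, (((Sig t - S) *ᵥ w t) j) ^ 2) / m ^ 2 := by fun_prop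
      simpa [Function.comp_def] using (hF.tendsto (Sig t)).comp hS
    refine tendsto_pi_nhds.2 fun j => tendsto_sub_nhds_zero_iff.1 ?_
    suffices h : Tendsto (fun s => (w s j - w t j) ^ 2) (𝓝[E] t) (𝓝 0) by
      refine (tendsto_zero_iff_abs_tendsto_zero _).2 ?_
      simpa [Function.comp_def, Real.sqrt_sq_eq_abs] using h.sqrt
    refine squeeze_zero' (Eventually.of_forall fun s => sq_nonneg _) ?_ hbound
    filter_upwards [self_mem_nhdsWithin] with s hs
    rw [le_div_iff₀' (by positivity)]
    refine le_trans ?_ (sq_mul_sum_sq_sub_le hm (hunif s hs) (v := w s) (w := w t) (T := Sig t)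
      ?_ ?_)
    · exact mul_le_mul_of_nonneg_left (Finset.single_le_sum
        (f := fun i => (w s i - w t i) ^ 2) (fun i _ => sq_nonneg _) (Finset.mem_univ j))
        (sq_nonneg m)
    · rw [hSw t ht, hSw s hs]
      exact hvar s hs _ (hfeas t ht)
    · rw [hSw t ht, hSw s hs]
      exact hvar t ht _ (hfeas s hs)
  have hbcont : ContinuousOn btil E := by
    have hF : ContinuousOn (fun t => Sig t *ᵥ w t) E := by fun_prop
    exact hF.congr fun t ht => (hSw t ht).symm
  have hIsub : ∀ t ∈ E, ∀ᶠ s in 𝓝[E] t, I t ⊆ I s := by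
    intro t ht
    have : ∀ j, ∀ᶠ s in 𝓝[E] t, j ∈ I t → j ∈ I s := by
      intro j
      by_cases hj : j ∈ I t
      · rw [hI] at hj
        filter_upwards [self_mem_nhdsWithin,
          (tendsto_pi_nhds.1 (hwcont t ht) j).eventually_const_lt hj.2] with s hs hpos _
        rw [hI]
        refine ⟨?_, hpos⟩
        by_contra hne
        exact hpos.ne' (hslack s hs j (lt_of_le_of_ne (hfeas s hs j) (Ne.symm hne)))
      · exact Eventually.of_forall fun s h => absurd h hj
    filter_upwards [eventually_all.2 this] with s hs j using hs j
  have hLsub : ∀ t ∈ E, ∀ᶠ s in 𝓝[E] t, L t ⊆ L s := by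
    intro t ht
    have : ∀ j, ∀ᶠ s in 𝓝[E] t, j ∈ L t → j ∈ L s := by
      intro j
      by_cases hj : j ∈ L t
      · rw [hL] at hj
        filter_upwards [self_mem_nhdsWithin,
          (tendsto_pi_nhds.1 (hbcont t ht) j).eventually_const_lt hj.1] with s hs hlt _
        rw [hL]
        exact ⟨hlt, hslack s hs j hlt⟩
      · exact Eventually.of_forall fun s h => absurd h hj
    filter_upwards [eventually_all.2 this] with s hs j using hs j
  have hKcompl : ∀ t ∈ E, (K t)ᶜ = I t ∪ L t := by
    intro t ht
    ext j
    rw [Set.mem_compl_iff, Set.mem_union, hK, hI, hL]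
    constructor
    · intro h
      rcases (hfeas t ht j).eq_or_lt with hj | hj
      · exact Or.inl ⟨hj.symm, lt_of_le_of_ne (hnonneg t ht j) fun h0 => h ⟨hj.symm, h0.symm⟩⟩
      · exact Or.inr ⟨hj, hslack t ht j hj⟩
    · rintro (h | h) hk
      · exact h.2.ne' hk.2
      · exact h.1.ne' hk.1
  have hKsub : ∀ t ∈ E, ∀ᶠ s in 𝓝[E] t, (K t)ᶜ ⊆ (K s)ᶜ := by
    intro t ht
    filter_upwards [self_mem_nhdsWithin, hIsub t ht, hLsub t ht] with s hs h1 h2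
    rw [hKcompl t ht, hKcompl s hs]
    exact Set.union_subset_union h1 h2
  refine ⟨⟨exists_locallyClosed_cover_of_eventually_subset hE.isClosed I hIsub,
    exists_locallyClosed_cover_of_eventually_subset hE.isClosed L hLsub, ?_⟩, ?_⟩
  · simpa only [compl_inj_iff] using
      exists_locallyClosed_cover_of_eventually_subset hE.isClosed (fun t => (K t)ᶜ) hKsub
  · intro t ht
    obtain ⟨ε, hε, h⟩ := Metric.mem_nhdsWithin_iff.1
      ((hIsub t ht).and ((hLsub t ht).and (hKsub t ht)))
    refine ⟨ε, hε, fun s hs hst => ?_⟩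
    obtain ⟨h1, h2, h3⟩ := h ⟨hst, hs⟩
    exact ⟨h1, h2, Set.compl_subset_compl.1 h3⟩
end

section
/- Let (ξ, η) be an ℝ^d × ℝ^d-valued Gaussian random vector such that ξ and η are each centered, and let c, e ∈ ℝ^d be deterministic vectors. Then ∫_{ℝ^d} e^{𝟙ᵀx}·P(ξ − c > x and η − e > x) dx ≤ exp(−½·𝟙ᵀ(c + e) + ⅛·𝟙ᵀM𝟙), where M = E[(ξ+η)(ξ+η)ᵀ], 𝟙 = (1,…,1)ᵀ ∈ ℝ^d, and all vector inequalities are componentwise. -/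
open MeasureTheory ProbabilityTheory Real

/-- The exponential mass of the open orthant below `y` is `exp (∑ i, y i)`. -/
lemma lintegral_exp_sum_mul_indicator_lt {ι : Type*} [Fintype ι] (y : ι → ℝ) :
    ∫⁻ x : ι → ℝ, ENNReal.ofReal (exp (∑ i, x i)) *
        Set.indicator {z : ι → ℝ | ∀ i, x i < z i} 1 y
      = ENNReal.ofReal (exp (∑ i, y i)) := by
  classical
  set f : ι → ℝ → ℝ := fun i => (Set.Iio (y i)).indicator exp
  have hf_nonneg : ∀ i t, 0 ≤ f i t := fun i t =>
    Set.indicator_nonneg (fun _ _ => (exp_pos _).le) t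
  have hf_int : ∀ i, Integrable (f i) volume := fun i =>
    ((integrableOn_exp_Iic (y i)).mono_set Set.Iio_subset_Iic_self).integrable_indicator
      measurableSet_Iio
  have hf_integral : ∀ i, ∫ t, f i t = exp (y i) := fun i => by
    rw [integral_indicator measurableSet_Iio, ← integral_Iic_eq_integral_Iio, integral_exp_Iic]
  have hprod : ∀ x : ι → ℝ, ENNReal.ofReal (exp (∑ i, x i)) *
      Set.indicator {z : ι → ℝ | ∀ i, x i < z i} 1 y = ENNReal.ofReal (∏ i, f i (x i)) := by
    intro x
    by_cases h : ∀ i, x i < y i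
    · have hx : ∀ i, f i (x i) = exp (x i) := fun i => Set.indicator_of_mem (Set.mem_Iio.mpr (h i)) _
      simp [hx, h, exp_sum]
    · obtain ⟨i, hi⟩ := not_forall.mp h
      have hx : f i (x i) = 0 := Set.indicator_of_notMem (mt Set.mem_Iio.mp hi) _
      rw [Finset.prod_eq_zero (Finset.mem_univ i) hx]
      simp [h]
  simp_rw [hprod]
  have hprod_int : Integrable (fun x : ι → ℝ => ∏ i, f i (x i)) volume :=
    Integrable.fintype_prod hf_int
  rw [← ofReal_integral_eq_lintegral_ofReal hprod_int
    (ae_of_all _ fun x => Finset.prod_nonneg fun i _ => hf_nonneg i (x i)),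
    integral_fintype_prod_volume_eq_prod]
  simp_rw [hf_integral, exp_sum]

/-- Tonelli: `∫ e^{𝟙ᵀx} P(x < Y) dx = E[e^{𝟙ᵀY}]`. -/
lemma lintegral_exp_sum_mul_measure_lt {ι Ω : Type*} [Fintype ι] [MeasurableSpace Ω]
    {μ : Measure Ω} [SFinite μ] {Y : Ω → ι → ℝ} (hY : Measurable Y) :
    ∫⁻ x : ι → ℝ, ENNReal.ofReal (exp (∑ i, x i)) * μ {ω | ∀ i, x i < Y ω i}
      = ∫⁻ ω, ENNReal.ofReal (exp (∑ i, Y ω i)) ∂μ := by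
  have hmeas : Measurable fun p : (ι → ℝ) × Ω => ENNReal.ofReal (exp (∑ i, p.1 i)) *
      Set.indicator {z : ι → ℝ | ∀ i, p.1 i < z i} (1 : (ι → ℝ) → ENNReal) (Y p.2) := by
    have hset : MeasurableSet {p : (ι → ℝ) × Ω | ∀ i, p.1 i < Y p.2 i} := by
      rw [Set.ofPred_forall]
      exact MeasurableSet.iInter fun i => measurableSet_lt (by fun_prop) (by fun_prop)
    exact Measurable.mul (by fun_prop)
      ((measurable_const (a := (1 : ENNReal))).indicator hset)
  have hslice : ∀ x : ι → ℝ, ENNReal.ofReal (exp (∑ i, x i)) * μ {ω | ∀ i, x i < Y ω i}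
      = ∫⁻ ω, ENNReal.ofReal (exp (∑ i, x i)) *
        Set.indicator {z : ι → ℝ | ∀ i, x i < z i} 1 (Y ω) ∂μ := by
    intro x
    have hset : MeasurableSet {ω | ∀ i, x i < Y ω i} := by
      rw [Set.ofPred_forall]
      exact MeasurableSet.iInter fun i => measurableSet_lt (by fun_prop) (by fun_prop)
    rw [lintegral_const_mul' _ _ ENNReal.ofReal_ne_top, ← lintegral_indicator_one hset]
    rfl
  simp_rw [hslice]
  rw [lintegral_lintegral_swap hmeas.aemeasurable]
  simp_rw [lintegral_exp_sum_mul_indicator_lt]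

/-- A real random variable with a Gaussian law is square integrable. -/
lemma memLp_two_of_map_eq_gaussianReal {Ω : Type*} [MeasurableSpace Ω] {μ : Measure Ω}
    {X : Ω → ℝ} (hX : AEMeasurable X μ) {m : ℝ} {v : NNReal}
    (h : μ.map X = gaussianReal m v) : MemLp X 2 μ := by
  have hid : MemLp id 2 (μ.map X) := h ▸ memLp_id_gaussianReal 2
  exact (memLp_map_measure_iff hid.aestronglyMeasurable hX).mp hid

/-- The second moment of a centered Gaussian real random variable is its variance. -/
lemma integral_sq_of_map_eq_gaussianReal {Ω : Type*} [MeasurableSpace Ω] {μ : Measure Ω}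
    {X : Ω → ℝ} (hX : AEMeasurable X μ) {v : NNReal}
    (h : μ.map X = gaussianReal 0 v) : ∫ ω, X ω ^ 2 ∂μ = v := by
  have hvar := variance_fun_id_gaussianReal (μ := 0) (v := v)
  rw [variance_of_integral_eq_zero aemeasurable_id' integral_id_gaussianReal, ← h,
    integral_map hX (by fun_prop)] at hvar
  exact hvar

/-- If `(ξ, η)` is a jointly Gaussian pair of `ℝ^d`-valued random vectors,
each centered, and `c, e ∈ ℝ^d` are deterministic, then
`∫_{ℝ^d} e^{𝟙ᵀx}·P(ξ − c > x, η − e > x) dx ≤ exp(−½·𝟙ᵀ(c+e) + ⅛·𝟙ᵀM𝟙)`, where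
`M = E[(ξ+η)(ξ+η)ᵀ]`. Joint centered Gaussianity is encoded by: every linear functional of the
pair is a centered real Gaussian. -/
theorem stmt_3 {d : ℕ} (hd : 1 ≤ d) {Ω : Type*} [MeasureSpace Ω]
    [IsProbabilityMeasure (ℙ : Measure Ω)]
    (ξ η : Ω → Fin d → ℝ) (hξ : Measurable ξ) (hη : Measurable η)
    (c e : Fin d → ℝ) (M : Matrix (Fin d) (Fin d) ℝ)
    (hgauss : ∀ l m : Fin d → ℝ, ∃ v : NNReal,
      Measure.map (fun ω => ∑ i, l i * ξ ω i + ∑ i, m i * η ω i) ℙ = gaussianReal 0 v)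
    (hM : ∀ i j, M i j = ∫ ω, (ξ ω i + η ω i) * (ξ ω j + η ω j)) :
    ∫ x : Fin d → ℝ,
        Real.exp (∑ i, x i) *
          (ℙ {ω | (∀ i, x i < ξ ω i - c i) ∧ (∀ i, x i < η ω i - e i)}).toReal
      ≤ Real.exp (-(1 / 2) * (∑ i, (c i + e i)) + (1 / 8) * ∑ i, ∑ j, M i j) := by
  set S : Ω → ℝ := fun ω => ∑ i, (ξ ω i + η ω i)
  have hS : Measurable S := by fun_prop
  obtain ⟨v, hv⟩ : ∃ v : NNReal, Measure.map S ℙ = gaussianReal 0 v := by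
    obtain ⟨v, hv⟩ := hgauss 1 1
    refine ⟨v, ?_⟩
    simpa [S, Finset.sum_add_distrib] using hv
  have hcoord : ∀ i, MemLp (fun ω => ξ ω i + η ω i) 2 (ℙ : Measure Ω) := by
    intro i
    obtain ⟨w, hw⟩ := hgauss (Pi.single i 1) (Pi.single i 1)
    refine memLp_two_of_map_eq_gaussianReal (by fun_prop) (m := 0) (v := w) ?_
    simpa [Pi.single_apply] using hw
  have hMv : ∑ i, ∑ j, M i j = v := by
    have h_int : ∀ i j, Integrable (fun ω => (ξ ω i + η ω i) * (ξ ω j + η ω j)) ℙ :=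
      fun i j => (hcoord i).integrable_mul (hcoord j)
    rw [← integral_sq_of_map_eq_gaussianReal hS.aemeasurable hv]
    simp_rw [hM, S, sq, Finset.sum_mul_sum]
    rw [integral_finsetSum _ fun i _ => integrable_finsetSum _ fun j _ => h_int i j]
    exact Finset.sum_congr rfl fun i _ => (integral_finsetSum _ fun j _ => h_int i j).symm
  set Y : Ω → Fin d → ℝ := fun ω i => (ξ ω i + η ω i - c i - e i) / 2
  have hY : Measurable Y := by fun_prop
  have hYS : ∀ ω, exp (∑ i, Y ω i) =
      exp (-(1 / 2) * ∑ i, (c i + e i)) * exp (1 / 2 * S ω) := by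
    intro ω
    rw [← exp_add]
    simp only [Y, S, Finset.mul_sum, ← Finset.sum_add_distrib]
    congr 1
    exact Finset.sum_congr rfl fun i _ => by ring
  have hexp_int : Integrable (fun ω => exp (1 / 2 * S ω)) ℙ := by
    have h := integrable_exp_mul_gaussianReal (μ := 0) (v := v) (1 / 2)
    rw [← hv] at h
    exact h.comp_measurable hS
  have hmgf : ∫ ω, exp (1 / 2 * S ω) = exp (1 / 8 * v) := by
    have h := mgf_gaussianReal hv (1 / 2)
    rw [mgf] at h
    rw [h]
    congr 1
    ring
  have hbound : ∫⁻ x : Fin d → ℝ, ENNReal.ofReal (exp (∑ i, x i) *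
      (ℙ {ω | (∀ i, x i < ξ ω i - c i) ∧ (∀ i, x i < η ω i - e i)}).toReal)
      ≤ ENNReal.ofReal (exp (-(1 / 2) * (∑ i, (c i + e i)) + (1 / 8) * ∑ i, ∑ j, M i j)) := by
    calc
      _ ≤ ∫⁻ x : Fin d → ℝ, ENNReal.ofReal (exp (∑ i, x i)) *
          (ℙ : Measure Ω) {ω | ∀ i, x i < Y ω i} := by
        refine lintegral_mono fun x => ?_
        rw [ENNReal.ofReal_mul (exp_pos _).le, ENNReal.ofReal_toReal (measure_ne_top _ _)]
        refine mul_le_mul' le_rfl (measure_mono ?_)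
        rintro ω ⟨h₁, h₂⟩ i
        have h₁ := h₁ i
        have h₂ := h₂ i
        simp only [Y]
        linarith
      _ = ∫⁻ ω, ENNReal.ofReal (exp (∑ i, Y ω i)) := lintegral_exp_sum_mul_measure_lt hY
      _ = _ := by
        simp_rw [hYS]
        rw [← ofReal_integral_eq_lintegral_ofReal (hexp_int.const_mul _)
          (ae_of_all _ fun ω => by positivity), integral_const_mul, hmgf, hMv, exp_add]
  by_cases h_int : Integrable fun x : Fin d → ℝ => exp (∑ i, x i) *
      (ℙ {ω | (∀ i, x i < ξ ω i - c i) ∧ (∀ i, x i < η ω i - e i)}).toReal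
  · rwa [← ofReal_integral_eq_lintegral_ofReal h_int (ae_of_all _ fun x => by positivity),
      ENNReal.ofReal_le_ofReal_iff (exp_pos _).le] at hbound
  · rw [integral_undef h_int]
    exact (exp_pos _).le
end

section
/- Let X(t), t ∈ [0,T], be a separable centered real-valued Gaussian process with almost surely continuous sample paths, and let a, b ≥ 0 with a + b > 0. For ε > 0 set D_ε = {(t₁,t₂) ∈ [0,T]² : |t₁ − t₂| < ε}. Suppose there is a function f such that E[(X(t+l) − X(t))²] < f(l) for all t ∈ [0,T] and l > 0, and f(l) → 0 as l → 0. Then for every δ > 0 there exists ε > 0 such that P{∃ (t₁,t₂) ∈ D_ε : X(t₁) > a·u and X(t₂) < −b·u} = o(e^{−δu²}) as u → ∞. -/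
open MeasureTheory ProbabilityTheory Filter Asymptotics

open scoped ENNReal NNReal Topology

/-- The exponent constant in Fernique's tail bound for balls of measure at least `3 / 4`. -/
noncomputable def ferniqueExponent : ℝ := Fernique.logRatio (ENNReal.ofReal (3 / 4))

lemma two_inv_lt_ofReal_three_quarters : (2 : ℝ≥0∞)⁻¹ < ENNReal.ofReal (3 / 4) := by
  rw [← ENNReal.ofReal_ofNat 2, ← ENNReal.ofReal_inv_of_pos (by norm_num),
    ENNReal.ofReal_lt_ofReal_iff (by norm_num)]
  norm_num

lemma ofReal_three_quarters_lt_one : ENNReal.ofReal (3 / 4) < 1 := by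
  rw [ENNReal.ofReal_lt_one]
  norm_num

lemma ferniqueExponent_pos : 0 < ferniqueExponent :=
  Fernique.logRatio_pos two_inv_lt_ofReal_three_quarters ofReal_three_quarters_lt_one

/-- A universal upper bound on the exponential square moment in Fernique's theorem for balls of
measure at least `3 / 4`. -/
noncomputable def ferniqueBound : ℝ≥0∞ :=
  .ofReal (Real.exp (Fernique.logRatio (ENNReal.ofReal (3 / 4)))) +
    ∑' n, .ofReal (Real.exp (-2⁻¹ *
      Real.log (ENNReal.ofReal (3 / 4) / (1 - ENNReal.ofReal (3 / 4))).toReal * 2 ^ n))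

lemma toReal_three_quarters_div :
    (ENNReal.ofReal (3 / 4) / (1 - ENNReal.ofReal (3 / 4))).toReal = 3 := by
  rw [ENNReal.toReal_div, ENNReal.toReal_sub_of_le ofReal_three_quarters_lt_one.le (by simp),
    ENNReal.toReal_ofReal (by norm_num)]
  norm_num

lemma ferniqueBound_ne_top : ferniqueBound ≠ ∞ := by
  refine ENNReal.add_ne_top.2 ⟨ENNReal.ofReal_ne_top, ?_⟩
  rw [toReal_three_quarters_div]
  have hlog : 0 < Real.log 3 := Real.log_pos (by norm_num)
  exact (Summable.tsum_ofReal_lt_top (Real.summable_exp_nat_mul_of_ge (by linarith)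
    fun n => mod_cast (Nat.lt_pow_self (by simp)).le)).ne

/-- **Fernique's tail bound**: the constants do not depend on the centered Gaussian measure, only
on the radius of a ball of measure at least `3 / 4`. -/
lemma measure_le_norm_le_of_isGaussian {E : Type*} [NormedAddCommGroup E] [NormedSpace ℝ E]
    [SecondCountableTopology E] [CompleteSpace E] [MeasurableSpace E] [BorelSpace E]
    (μ : Measure E) [IsGaussian μ] (hμ : ∀ L : StrongDual ℝ E, μ[L] = 0)
    {r t : ℝ} (ht : 0 ≤ t) (hr : ENNReal.ofReal (3 / 4) ≤ μ {x | ‖x‖ ≤ r}) :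
    μ {x | t ≤ ‖x‖} ≤
      ferniqueBound * ENNReal.ofReal (Real.exp (-(ferniqueExponent * r⁻¹ ^ 2 * t ^ 2))) := by
  have hpos := ferniqueExponent_pos
  have hint : ∫⁻ x, .ofReal (Real.exp (ferniqueExponent * r⁻¹ ^ 2 * ‖x‖ ^ 2)) ∂μ
      ≤ ferniqueBound :=
    lintegral_exp_mul_sq_norm_le_of_map_rotation_eq_self
      (IsGaussian.map_rotation_eq_self_of_forall_strongDual_eq_zero hμ _) hr
      two_inv_lt_ofReal_three_quarters
  calc μ {x | t ≤ ‖x‖}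
  _ ≤ μ {x | ENNReal.ofReal (Real.exp (ferniqueExponent * r⁻¹ ^ 2 * t ^ 2)) ≤
        .ofReal (Real.exp (ferniqueExponent * r⁻¹ ^ 2 * ‖x‖ ^ 2))} := by
    refine measure_mono fun x (hx : t ≤ ‖x‖) => ?_
    simp only [Set.mem_ofPred_eq]
    gcongr
  _ ≤ (∫⁻ x, .ofReal (Real.exp (ferniqueExponent * r⁻¹ ^ 2 * ‖x‖ ^ 2)) ∂μ) /
        ENNReal.ofReal (Real.exp (ferniqueExponent * r⁻¹ ^ 2 * t ^ 2)) :=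
    meas_ge_le_lintegral_div (by fun_prop) (by simp [Real.exp_pos]) ENNReal.ofReal_ne_top
  _ ≤ ferniqueBound / ENNReal.ofReal (Real.exp (ferniqueExponent * r⁻¹ ^ 2 * t ^ 2)) := by gcongr
  _ = _ := by
    rw [Real.exp_neg, ENNReal.ofReal_inv_of_pos (Real.exp_pos _), div_eq_mul_inv]

/-- Fernique's tail bound for the supremum of a finite jointly Gaussian centered family. -/
lemma measure_exists_le_abs_le_of_fintype {Ω ι : Type*} [MeasurableSpace Ω] (P : Measure Ω)
    [IsProbabilityMeasure P] [Fintype ι] (Y : ι → Ω → ℝ) (hY : ∀ i, Measurable (Y i))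
    (hgauss : ∀ l : ι → ℝ, ∃ v : ℝ≥0, P.map (fun ω => ∑ i, l i * Y i ω) = gaussianReal 0 v)
    {r t : ℝ} (hr0 : 0 ≤ r) (ht : 0 ≤ t)
    (hr : ENNReal.ofReal (3 / 4) ≤ P {ω | ∀ i, |Y i ω| ≤ r}) :
    P {ω | ∃ i, t ≤ |Y i ω|} ≤
      ferniqueBound * ENNReal.ofReal (Real.exp (-(ferniqueExponent * r⁻¹ ^ 2 * t ^ 2))) := by
  have hmeas : Measurable fun ω i => Y i ω := measurable_pi_lambda _ hY
  set μ : Measure (ι → ℝ) := P.map fun ω i => Y i ω with hμ_def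
  have hmap (L : (ι → ℝ) →L[ℝ] ℝ) : ∃ v : ℝ≥0, μ.map L = gaussianReal 0 v := by
    classical
    obtain ⟨v, hv⟩ := hgauss fun i => L fun j => if i = j then 1 else 0
    refine ⟨v, ?_⟩
    rw [← hv, hμ_def, Measure.map_map (by fun_prop) hmeas]
    congr 1
    ext ω
    have := LinearMap.pi_apply_eq_sum_univ (L : (ι → ℝ) →ₗ[ℝ] ℝ) (fun i => Y i ω)
    simp only [ContinuousLinearMap.coe_coe, smul_eq_mul] at this
    simp only [Function.comp_apply, this, mul_comm]
  have hG : IsGaussian μ := isGaussian_of_map_eq_gaussianReal fun L => ⟨0, hmap L⟩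
  have hcentered (L : StrongDual ℝ (ι → ℝ)) : μ[L] = 0 := by
    obtain ⟨v, hv⟩ := hmap L
    have h := integral_map (μ := μ) (φ := L) (f := id) (by fun_prop) (by fun_prop)
    rw [hv] at h
    simpa using h.symm
  have hball : P {ω | ∀ i, |Y i ω| ≤ r} = μ {x | ‖x‖ ≤ r} := by
    rw [hμ_def, Measure.map_apply hmeas (measurableSet_le (by fun_prop) (by fun_prop))]
    simp [pi_norm_le_iff_of_nonneg hr0]
  refine le_trans ?_ (measure_le_norm_le_of_isGaussian μ hcentered ht (hball ▸ hr))
  rw [hμ_def, Measure.map_apply hmeas (measurableSet_le (by fun_prop) (by fun_prop))]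
  refine measure_mono ?_
  rintro ω ⟨i, hi⟩
  exact hi.trans (norm_le_pi_norm (fun i => Y i ω) i)

/-- Fernique's tail bound for the supremum of a countable jointly Gaussian centered family. -/
lemma measure_exists_le_abs_le_of_countable {Ω ι : Type*} [MeasurableSpace Ω] (P : Measure Ω)
    [IsProbabilityMeasure P] [Countable ι] (Y : ι → Ω → ℝ) (hY : ∀ i, Measurable (Y i))
    (hgauss : ∀ (s : Finset ι) (l : s → ℝ), ∃ v : ℝ≥0,
      P.map (fun ω => ∑ i : s, l i * Y i ω) = gaussianReal 0 v)
    {r t : ℝ} (hr0 : 0 ≤ r) (ht : 0 ≤ t)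
    (hr : ENNReal.ofReal (3 / 4) ≤ P {ω | ∀ i, |Y i ω| ≤ r}) :
    P {ω | ∃ i, t ≤ |Y i ω|} ≤
      ferniqueBound * ENNReal.ofReal (Real.exp (-(ferniqueExponent * r⁻¹ ^ 2 * t ^ 2))) := by
  have hunion : {ω | ∃ i, t ≤ |Y i ω|} = ⋃ s : Finset ι, {ω | ∃ i : s, t ≤ |Y i ω|} := by
    ext ω
    simp only [Set.mem_ofPred_eq, Set.mem_iUnion]
    exact ⟨fun ⟨i, hi⟩ => ⟨{i}, ⟨i, by simp⟩, hi⟩, fun ⟨_, i, hi⟩ => ⟨i, hi⟩⟩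
  have hmono : Monotone fun s : Finset ι => {ω | ∃ i : s, t ≤ |Y i ω|} :=
    fun s s' hss ω ⟨i, hi⟩ => ⟨⟨i, hss i.2⟩, hi⟩
  rw [hunion, hmono.directed_le.measure_iUnion]
  refine iSup_le fun s => measure_exists_le_abs_le_of_fintype P (fun i : s => Y i)
    (fun i => hY i) (hgauss s) hr0 ht (hr.trans (measure_mono fun ω hω i => hω i))

/-- A process with almost surely continuous paths on a compact space has, with probability close to
`1`, small oscillation over the pairs of points of a sequence at distance less than some `ε`. -/
lemma exists_pos_lt_measure_forall_abs_sub_le {Ω I : Type*} [MeasurableSpace Ω] (P : Measure Ω)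
    [IsProbabilityMeasure P] [PseudoMetricSpace I] [CompactSpace I] (X : I → Ω → ℝ)
    (hcont : ∀ᵐ ω ∂P, Continuous fun t => X t ω) (D : ℕ → I)
    {r : ℝ} (hr : 0 < r) {c : ℝ≥0∞} (hc : c < 1) :
    ∃ ε > 0, c < P {ω | ∀ p : {p : ℕ × ℕ // dist (D p.1) (D p.2) < ε},
      |X (D p.1.1) ω - X (D p.1.2) ω| ≤ r} := by
  set A : ℕ → Set Ω := fun n => {ω | ∀ p : {p : ℕ × ℕ // dist (D p.1) (D p.2) < 1 / ((n : ℝ) + 1)},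
      |X (D p.1.1) ω - X (D p.1.2) ω| ≤ r}
  have hmono : Monotone A := fun m n hmn ω hω p =>
    hω ⟨p.1, p.2.trans_le (one_div_le_one_div_of_le (by positivity) (by gcongr))⟩
  have hA : P (⋃ n, A n) = 1 := by
    refine (measure_congr (eventuallyEq_univ.2 ?_)).trans measure_univ
    filter_upwards [hcont] with ω hω
    have huc := CompactSpace.uniformContinuous_of_continuous hω
    obtain ⟨ε, hε, h⟩ := Metric.uniformContinuous_iff.1 huc r hr
    obtain ⟨n, hn⟩ := exists_nat_one_div_lt hε
    exact Set.mem_iUnion.2 ⟨n, fun p => (h (p.2.trans hn)).le⟩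
  have htend := tendsto_measure_iUnion_atTop (μ := P) hmono
  rw [hA] at htend
  obtain ⟨n, hn⟩ := (htend.eventually (lt_mem_nhds hc)).exists
  exact ⟨1 / ((n : ℝ) + 1), by positivity, hn⟩

/-- For a centered Gaussian process with almost surely continuous paths on a compact metric space,
the increments over sufficiently small distances have Gaussian tails of any prescribed rate. -/
lemma exists_pos_measure_exists_lt_sub_le {Ω I : Type*} [MeasurableSpace Ω] (P : Measure Ω)
    [IsProbabilityMeasure P] [PseudoMetricSpace I] [CompactSpace I] [Nonempty I]
    (X : I → Ω → ℝ) (hmeas : ∀ t, Measurable (X t))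
    (hgauss : ∀ (m : ℕ) (ts : Fin m → I) (l : Fin m → ℝ), ∃ v : ℝ≥0,
      P.map (fun ω => ∑ k, l k * X (ts k) ω) = gaussianReal 0 v)
    (hcont : ∀ᵐ ω ∂P, Continuous fun t => X t ω) {C : ℝ} (hC : 0 < C) :
    ∃ ε > 0, ∀ t ≥ 0, P {ω | ∃ t₁ t₂, dist t₁ t₂ < ε ∧ t < X t₁ ω - X t₂ ω} ≤
      ferniqueBound * ENNReal.ofReal (Real.exp (-(C * t ^ 2))) := by
  have hgauss' {α : Type} [Fintype α] (ts : α → I) (l : α → ℝ) : ∃ v : ℝ≥0,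
      P.map (fun ω => ∑ k, l k * X (ts k) ω) = gaussianReal 0 v := by
    obtain ⟨v, hv⟩ := hgauss _ (ts ∘ (Fintype.equivFin α).symm) (l ∘ (Fintype.equivFin α).symm)
    refine ⟨v, hv ▸ ?_⟩
    congr 1
    ext ω
    exact ((Fintype.equivFin α).symm.sum_comp fun k => l k * X (ts k) ω).symm
  have hκ := ferniqueExponent_pos
  set r : ℝ := √(ferniqueExponent / C)
  have hr : 0 < r := Real.sqrt_pos.2 (by positivity)
  have hrC : ferniqueExponent * r⁻¹ ^ 2 = C := by
    rw [inv_pow, Real.sq_sqrt (by positivity)]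
    field_simp
  set D : ℕ → I := TopologicalSpace.denseSeq I
  obtain ⟨ε, hε, hlt⟩ := exists_pos_lt_measure_forall_abs_sub_le P X hcont D hr
    ofReal_three_quarters_lt_one
  refine ⟨ε, hε, fun t ht => ?_⟩
  have hbound := measure_exists_le_abs_le_of_countable P
    (fun (p : {p : ℕ × ℕ // dist (D p.1) (D p.2) < ε}) ω => X (D p.1.1) ω - X (D p.1.2) ω)
    (fun p => (hmeas _).sub (hmeas _)) (fun s l => ?_) hr.le ht hlt.le
  · rw [hrC] at hbound
    refine (measure_mono_ae ?_).trans hbound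
    filter_upwards [hcont] with ω hω
    rintro ⟨t₁, t₂, hd, ht'⟩
    have hopen : IsOpen {p : I × I | dist p.1 p.2 < ε ∧ t < X p.1 ω - X p.2 ω} :=
      (isOpen_lt continuous_dist continuous_const).inter (isOpen_lt continuous_const
        ((hω.comp continuous_fst).sub (hω.comp continuous_snd)))
    have hdense : DenseRange (Prod.map D D) :=
      (TopologicalSpace.denseRange_denseSeq I).prodMap (TopologicalSpace.denseRange_denseSeq I)
    obtain ⟨p, hp⟩ := hdense.exists_mem_open hopen ⟨(t₁, t₂), hd, ht'⟩
    exact ⟨⟨p, hp.1⟩, hp.2.le.trans (le_abs_self _)⟩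
  · obtain ⟨v, hv⟩ := hgauss' (α := s ⊕ s)
      (Sum.elim (fun p => D p.1.1.1) fun p => D p.1.1.2) (Sum.elim l fun p => -l p)
    refine ⟨v, hv ▸ ?_⟩
    congr 1
    ext ω
    simp only [Fintype.sum_sum_type, Sum.elim_inl, Sum.elim_inr, mul_sub, neg_mul,
      Finset.sum_sub_distrib, Finset.sum_neg_distrib, ← sub_eq_add_neg]

/-- Let `X(t)`, `t ∈ [0,T]`, be a centered Gaussian process with a.s.
continuous sample paths, `a, b ≥ 0` with `a + b > 0`, and for `ε > 0` let
`D_ε = {(t₁,t₂) ∈ [0,T]² : |t₁ − t₂| < ε}`. If `E[(X(t+l) − X(t))²] < f(l)` for all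
`t, t+l ∈ [0,T]`, `l > 0`, with `f(l) → 0` as `l ↓ 0`, then for every `δ > 0` there is
`ε > 0` with `P{∃ (t₁,t₂) ∈ D_ε : X(t₁) > au, X(t₂) < −bu} = o(e^{−δu²})` as `u → ∞`. -/
theorem stmt_4 {Ω : Type*} [MeasureSpace Ω] [IsProbabilityMeasure (ℙ : Measure Ω)]
    (T : ℝ) (hT : 0 < T) (a b : ℝ) (ha : 0 ≤ a) (hb : 0 ≤ b) (hab : 0 < a + b)
    (X : ℝ → Ω → ℝ)
    (hmeas : ∀ t, Measurable (X t))
    (hgauss : ∀ (m : ℕ) (ts : Fin m → ℝ), (∀ k, ts k ∈ Set.Icc 0 T) →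
      ∀ l : Fin m → ℝ, ∃ v : NNReal,
        Measure.map (fun ω => ∑ k, l k * X (ts k) ω) ℙ = gaussianReal 0 v)
    (hcont : ∀ᵐ ω ∂ℙ, ContinuousOn (fun t => X t ω) (Set.Icc 0 T))
    (f : ℝ → ℝ)
    (hbound : ∀ t l : ℝ, 0 ≤ t → 0 < l → t + l ≤ T →
      (∫ ω, (X (t + l) ω - X t ω) ^ 2) < f l)
    (hf : Tendsto f (nhdsWithin 0 (Set.Ioi 0)) (nhds 0)) :
    ∀ δ > (0 : ℝ), ∃ ε > (0 : ℝ),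
      (fun u : ℝ => (ℙ {ω | ∃ t₁ ∈ Set.Icc 0 T, ∃ t₂ ∈ Set.Icc 0 T,
            |t₁ - t₂| < ε ∧ a * u < X t₁ ω ∧ X t₂ ω < -(b * u)}).toReal)
        =o[atTop] fun u : ℝ => Real.exp (-δ * u ^ 2) := by
  intro δ hδ
  have : Nonempty (Set.Icc 0 T) := ⟨⟨0, le_rfl, hT.le⟩⟩
  obtain ⟨ε, hε, h⟩ := exists_pos_measure_exists_lt_sub_le (ℙ : Measure Ω)
    (fun t : Set.Icc 0 T => X t) (fun t => hmeas t)
    (fun m ts l => hgauss m (fun k => ts k) (fun k => (ts k).2) l)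
    (hcont.mono fun ω hω => continuousOn_iff_continuous_domRestrict.1 hω)
    (C := (δ + 1) / (a + b) ^ 2) (by positivity)
  refine ⟨ε, hε, ?_⟩
  have hbigO : (fun u : ℝ => (ℙ {ω | ∃ t₁ ∈ Set.Icc 0 T, ∃ t₂ ∈ Set.Icc 0 T,
      |t₁ - t₂| < ε ∧ a * u < X t₁ ω ∧ X t₂ ω < -(b * u)}).toReal)
        =O[atTop] fun u : ℝ => Real.exp (-(δ + 1) * u ^ 2) := by
    refine IsBigO.of_bound ferniqueBound.toReal ?_
    filter_upwards [eventually_ge_atTop 0] with u hu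
    have hexp : (δ + 1) / (a + b) ^ 2 * ((a + b) * u) ^ 2 = (δ + 1) * u ^ 2 := by
      field_simp
    have hle := h ((a + b) * u) (by positivity)
    rw [hexp, ← neg_mul] at hle
    rw [Real.norm_of_nonneg ENNReal.toReal_nonneg, Real.norm_of_nonneg (Real.exp_pos _).le,
      ← ENNReal.toReal_ofReal (Real.exp_pos _).le, ← ENNReal.toReal_mul]
    refine ENNReal.toReal_mono
      (ENNReal.mul_ne_top ferniqueBound_ne_top ENNReal.ofReal_ne_top) ((measure_mono ?_).trans hle)
    rintro ω ⟨t₁, ht₁, t₂, ht₂, hd, h₁, h₂⟩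
    exact ⟨⟨t₁, ht₁⟩, ⟨t₂, ht₂⟩, hd, by dsimp only; linarith⟩
  refine hbigO.trans_isLittleO ?_
  rw [Real.isLittleO_exp_comp_exp_comp]
  have hsub : (fun u : ℝ => -δ * u ^ 2 - -(δ + 1) * u ^ 2) = fun u => u ^ 2 := by
    ext u
    ring
  rw [hsub]
  exact tendsto_pow_atTop two_ne_zero
end

section
/- Let H ∈ (0,1) and define f(s) = (s^{2H} + 1 − (1−s)^{2H})/2 for s ∈ (0,1). Then the function A(s) = f(s)·s^{1−2H} is strictly increasing on (0,1); equivalently, s·f′(s) + (1 − 2H)·f(s) > 0 for all s ∈ (0,1), where f′(s) = H(s^{2H−1} + (1−s)^{2H−1}). -/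
open Real Set

/-- The positivity behind the monotonicity of `s ↦ (s ^ a + 1 - (1 - s) ^ a) * s ^ (1 - a)`. -/
lemma rpow_add_mul_rpow_add_pos {a s : ℝ} (ha : 0 < a) (ha2 : a < 2) (hs : 0 < s) (hs1 : s < 1) :
    0 < s ^ a + a * s * (1 - s) ^ (a - 1) + (1 - a) * (1 - (1 - s) ^ a) := by
  have ht : 0 < 1 - s := by linarith
  have hsa : 0 < s ^ a := rpow_pos_of_pos hs a
  have hta : 0 < (1 - s) ^ (a - 1) := rpow_pos_of_pos ht _
  rcases le_or_gt a 1 with h | h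
  · have h1 : (1 - s) ^ a ≤ 1 := rpow_le_one ht.le (by linarith) ha.le
    have h2 : 0 < a * s * (1 - s) ^ (a - 1) := by positivity
    have h3 := mul_nonneg (sub_nonneg.2 h) (sub_nonneg.2 h1)
    linarith
  · have h1 : s ^ 2 ≤ s ^ a := by
      rw [← rpow_two]
      exact rpow_le_rpow_of_exponent_ge hs hs1.le ha2.le
    have h2 : 1 - s ≤ (1 - s) ^ (a - 1) := by
      simpa using rpow_le_rpow_of_exponent_ge ht (by linarith) (by linarith : a - 1 ≤ 1)
    have h3 : (1 - s) ^ a = (1 - s) ^ (a - 1) * (1 - s) := by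
      rw [← rpow_add_one ht.ne', sub_add_cancel]
    have h4 := mul_le_mul_of_nonneg_right h2 (by linarith : 0 ≤ s + (a - 1))
    have h5 : 0 < s * (2 - a) := mul_pos hs (by linarith)
    rw [h3]
    linarith

/-- For `H ∈ (0,1)` and `f(s) = (s^{2H} + 1 − (1−s)^{2H})/2`, the function
`A(s) = f(s)·s^{1−2H}` is strictly increasing on `(0,1)`; equivalently,
`s·f′(s) + (1 − 2H)·f(s) > 0` on `(0,1)`, where `f′(s) = H(s^{2H−1} + (1−s)^{2H−1})`. -/
theorem stmt_6 (H : ℝ) (hH : H ∈ Set.Ioo (0 : ℝ) 1)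
    (f A : ℝ → ℝ)
    (hf : ∀ s, f s = (s ^ (2 * H) + 1 - (1 - s) ^ (2 * H)) / 2)
    (hA : ∀ s, A s = f s * s ^ (1 - 2 * H)) :
    StrictMonoOn A (Set.Ioo 0 1) ∧
      ∀ s ∈ Set.Ioo (0 : ℝ) 1,
        0 < s * (H * (s ^ (2 * H - 1) + (1 - s) ^ (2 * H - 1))) + (1 - 2 * H) * f s := by
  obtain ⟨hH0, hH1⟩ := hH
  have hpos : ∀ s ∈ Set.Ioo (0 : ℝ) 1,
      0 < s * (H * (s ^ (2 * H - 1) + (1 - s) ^ (2 * H - 1))) + (1 - 2 * H) * f s := by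
    rintro s ⟨hs, hs1⟩
    have key := rpow_add_mul_rpow_add_pos (a := 2 * H) (by linarith) (by linarith) hs hs1
    have h : s ^ (2 * H) = s ^ (2 * H - 1) * s := by
      rw [← rpow_add_one hs.ne', sub_add_cancel]
    rw [hf]
    rw [h] at key ⊢
    linarith
  have hderiv : ∀ s ∈ Set.Ioo (0 : ℝ) 1, HasDerivAt A
      (s ^ (-(2 * H)) *
        (s * (H * (s ^ (2 * H - 1) + (1 - s) ^ (2 * H - 1))) + (1 - 2 * H) * f s)) s := by
    rintro s ⟨hs, hs1⟩
    have ht : 1 - s ≠ 0 := by linarith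
    have hdf : HasDerivAt f (H * (s ^ (2 * H - 1) + (1 - s) ^ (2 * H - 1))) s := by
      rw [funext hf]
      refine ((((hasDerivAt_rpow_const (p := 2 * H) (Or.inl hs.ne')).add_const 1).sub
        (((hasDerivAt_id s).const_sub 1).rpow_const (p := 2 * H) (Or.inl ht))).div_const 2).congr_deriv ?_
      simp only [id]
      ring
    rw [funext hA]
    refine (hdf.mul (hasDerivAt_rpow_const (p := 1 - 2 * H) (Or.inl hs.ne'))).congr_deriv ?_
    rw [show 1 - 2 * H - 1 = -(2 * H) by ring, show 1 - 2 * H = -(2 * H) + 1 by ring,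
      rpow_add_one hs.ne']
    ring
  refine ⟨strictMonoOn_of_deriv_pos (convex_Ioo 0 1)
    (fun s hs => (hderiv s hs).continuousAt.continuousWithinAt) fun s hs => ?_, hpos⟩
  rw [interior_Ioo] at hs
  rw [(hderiv s hs).deriv]
  exact mul_pos (rpow_pos_of_pos hs.1 _) (hpos s hs)
end

section
/- Let H ∈ (0,1) and α > 0. Define f(s) = (s^{2H} + 1 − (1−s)^{2H})/2 and D_α(s) = (α + f(s))²/(s^{2H} − f(s)²) + 1 for s ∈ (0,1). Then s^{2H} − f(s)² > 0 on (0,1), D_α is twice differentiable on (0,1), and D_α attains a unique minimum at some point s* ∈ (0,1); moreover D_α′ < 0 on (0, s*), D_α′ > 0 on (s*, 1), and D_α″(s*) > 0. -/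
open Real Set

open Filter Topology

/-- The covariance `r(1, s)` of fractional Brownian motion with Hurst index `H`, for `s ≤ 1`. -/
noncomputable def fbmCov (H s : ℝ) : ℝ := (s ^ (2 * H) + 1 - (1 - s) ^ (2 * H)) / 2

/-- The function `A(s) = f(s) s^{1 - 2H}`, where `f` is the covariance `fbmCov H`. -/
noncomputable def fbmRatio (H s : ℝ) : ℝ := fbmCov H s * s ^ (1 - 2 * H)

/-- The factor of `D_α'` that carries its sign. -/
noncomputable def signFactor (H α s : ℝ) : ℝ :=
  α * (fbmRatio H s - fbmRatio H (1 - s)) - fbmRatio H (1 - s) + 1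

/-- The positive factor of `D_α'`. -/
noncomputable def posFactor (H α s : ℝ) : ℝ :=
  2 * H * (α + fbmCov H s) * s ^ (2 * H - 1) * (1 - s) ^ (2 * H - 1) /
    (s ^ (2 * H) - fbmCov H s ^ 2) ^ 2

lemma rpow_eq_mul_rpow_sub_one {s : ℝ} (hs : 0 < s) (m : ℝ) : s ^ m = s * s ^ (m - 1) := by
  rw [rpow_sub_one hs.ne']
  field_simp

lemma fbmCov_one_sub (H s : ℝ) : fbmCov H (1 - s) = 1 - fbmCov H s := by
  simp only [fbmCov, sub_sub_cancel]
  ring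

lemma fbmCov_pos {H s : ℝ} (hH : 0 < H) (h0 : 0 < s) (h1 : s < 1) : 0 < fbmCov H s := by
  have hp : 0 < s ^ (2 * H) := rpow_pos_of_pos h0 _
  have hq : (1 - s) ^ (2 * H) < 1 :=
    rpow_lt_one (by linarith) (by linarith) (by linarith)
  unfold fbmCov
  linarith

lemma rpow_sub_fbmCov_sq_pos {H s : ℝ} (hH0 : 0 < H) (hH1 : H < 1) (h0 : 0 < s) (h1 : s < 1) :
    0 < s ^ (2 * H) - fbmCov H s ^ 2 := by
  have hs' : 0 < 1 - s := by linarith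
  have ha : s < s ^ H := self_lt_rpow_of_lt_one h0 h1 hH1
  have hb : 1 - s < (1 - s) ^ H := self_lt_rpow_of_lt_one hs' (by linarith) hH1
  have hb1 : (1 - s) ^ H < 1 := rpow_lt_one hs'.le (by linarith) hH0
  have ha1 : s ^ H < 1 := rpow_lt_one h0.le h1 hH0
  have hp : s ^ (2 * H) = (s ^ H) ^ 2 := by
    rw [mul_comm, rpow_mul h0.le, rpow_two]
  have hq : (1 - s) ^ (2 * H) = ((1 - s) ^ H) ^ 2 := by
    rw [mul_comm, rpow_mul hs'.le, rpow_two]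
  rw [fbmCov, hp, hq]
  set a := s ^ H
  set b := (1 - s) ^ H
  have key : a ^ 2 - ((a ^ 2 + 1 - b ^ 2) / 2) ^ 2 =
      (b - (1 - a)) * (b + (1 - a)) * ((1 + a - b) * (1 + a + b)) / 4 := by ring
  rw [key]
  have e1 : 0 < b - (1 - a) := by linarith
  have e2 : 0 < b + (1 - a) := by linarith
  have e3 : 0 < 1 + a - b := by linarith
  have e4 : 0 < 1 + a + b := by linarith
  positivity

lemma hasDerivAt_one_sub_rpow {s : ℝ} (h1 : s < 1) (m : ℝ) :
    HasDerivAt (fun x : ℝ => (1 - x) ^ m) (-(m * (1 - s) ^ (m - 1))) s := by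
  have h := ((hasDerivAt_id s).const_sub 1).rpow_const (p := m) (Or.inl (by simp; linarith))
  exact h.congr_deriv (by simp)

lemma hasDerivAt_fbmCov (H : ℝ) {s : ℝ} (h0 : 0 < s) (h1 : s < 1) :
    HasDerivAt (fbmCov H) (H * (s ^ (2 * H - 1) + (1 - s) ^ (2 * H - 1))) s := by
  have h := (((hasDerivAt_rpow_const (p := 2 * H) (Or.inl h0.ne')).add_const 1).sub
    (hasDerivAt_one_sub_rpow h1 (2 * H))).div_const 2
  exact h.congr_deriv (by ring)

lemma hasDerivAt_fbmRatio (H : ℝ) {s : ℝ} (h0 : 0 < s) (h1 : s < 1) :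
    HasDerivAt (fbmRatio H)
      (H * (s ^ (2 * H - 1) + (1 - s) ^ (2 * H - 1)) * s ^ (1 - 2 * H) +
        fbmCov H s * ((1 - 2 * H) * s ^ (1 - 2 * H - 1))) s :=
  (hasDerivAt_fbmCov H h0 h1).mul (hasDerivAt_rpow_const (Or.inl h0.ne'))

lemma deriv_fbmRatio_pos {H s : ℝ} (hH0 : 0 < H) (hH1 : H < 1) (h0 : 0 < s) (h1 : s < 1) :
    0 < deriv (fbmRatio H) s := by
  have hs' : 0 < 1 - s := by linarith
  rw [(hasDerivAt_fbmRatio H h0 h1).deriv]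
  have hf := fbmCov_pos hH0 h0 h1
  have hu : 0 < s ^ (2 * H - 1) := rpow_pos_of_pos h0 _
  have hv : 0 < (1 - s) ^ (2 * H - 1) := rpow_pos_of_pos hs' _
  have hw : 0 < s ^ (1 - 2 * H - 1) := rpow_pos_of_pos h0 _
  rw [rpow_eq_mul_rpow_sub_one h0 (1 - 2 * H)]
  suffices h : 0 < H * (s ^ (2 * H - 1) + (1 - s) ^ (2 * H - 1)) * s +
      fbmCov H s * (1 - 2 * H) by
    calc 0 < (H * (s ^ (2 * H - 1) + (1 - s) ^ (2 * H - 1)) * s +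
        fbmCov H s * (1 - 2 * H)) * s ^ (1 - 2 * H - 1) := mul_pos h hw
      _ = _ := by ring
  rcases le_or_gt H (1 / 2) with hH | hH
  · have : 0 ≤ fbmCov H s * (1 - 2 * H) := mul_nonneg hf.le (by linarith)
    positivity
  · have hu1 : s ≤ s ^ (2 * H - 1) := self_le_rpow_of_le_one h0.le h1.le (by linarith)
    have hv1 : 1 - s ≤ (1 - s) ^ (2 * H - 1) :=
      self_le_rpow_of_le_one hs'.le (by linarith) (by linarith)
    rw [fbmCov, rpow_eq_mul_rpow_sub_one h0 (2 * H), rpow_eq_mul_rpow_sub_one hs' (2 * H)]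
    set u := s ^ (2 * H - 1)
    set v := (1 - s) ^ (2 * H - 1)
    have e1 : 0 ≤ s * (u - s) := mul_nonneg h0.le (by linarith)
    have e2 : 0 ≤ (2 * H - 1 + s) * (v - (1 - s)) :=
      mul_nonneg (by linarith) (by linarith)
    have e3 : 0 < s * (2 - 2 * H) := mul_pos h0 (by linarith)
    linarith

lemma hasDerivAt_signFactor (H α : ℝ) {s : ℝ} (h0 : 0 < s) (h1 : s < 1) :
    HasDerivAt (signFactor H α) (α * (deriv (fbmRatio H) s + deriv (fbmRatio H) (1 - s)) +
      deriv (fbmRatio H) (1 - s)) s := by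
  have hA := (hasDerivAt_fbmRatio H h0 h1).differentiableAt.hasDerivAt
  have hB : HasDerivAt (fun x => fbmRatio H (1 - x)) (-deriv (fbmRatio H) (1 - s)) s := by
    have hA' := (hasDerivAt_fbmRatio H (s := 1 - s) (by linarith)
      (by linarith)).differentiableAt.hasDerivAt
    exact (hA'.comp s ((hasDerivAt_id s).const_sub 1)).congr_deriv (by ring)
  exact ((((hA.sub hB).const_mul α).sub hB).add_const 1).congr_deriv (by ring)

lemma deriv_signFactor_pos {H α s : ℝ} (hH0 : 0 < H) (hH1 : H < 1) (hα : 0 < α)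
    (h0 : 0 < s) (h1 : s < 1) : 0 < deriv (signFactor H α) s := by
  rw [(hasDerivAt_signFactor H α h0 h1).deriv]
  have hA := deriv_fbmRatio_pos hH0 hH1 h0 h1
  have hB := deriv_fbmRatio_pos (s := 1 - s) hH0 hH1 (by linarith) (by linarith)
  positivity

lemma continuousOn_signFactor (H α : ℝ) : ContinuousOn (signFactor H α) (Ioo 0 1) :=
  fun _ hs => (hasDerivAt_signFactor H α hs.1 hs.2).continuousAt.continuousWithinAt

lemma strictMonoOn_signFactor {H α : ℝ} (hH0 : 0 < H) (hH1 : H < 1) (hα : 0 < α) :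
    StrictMonoOn (signFactor H α) (Ioo 0 1) :=
  strictMonoOn_of_deriv_pos (convex_Ioo 0 1) (continuousOn_signFactor H α) fun s hs => by
    rw [interior_Ioo] at hs
    exact deriv_signFactor_pos hH0 hH1 hα hs.1 hs.2

lemma fbmRatio_le {H s : ℝ} (hH1 : H < 1) (h0 : 0 < s) (h1 : s < 1) :
    fbmRatio H s ≤ s / 2 + s ^ (2 - 2 * H) := by
  have hq : (1 - s) ^ (2 : ℝ) ≤ (1 - s) ^ (2 * H) :=
    rpow_le_rpow_of_exponent_ge (by linarith) (by linarith) (by linarith)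
  rw [rpow_two] at hq
  have hw : 0 < s ^ (1 - 2 * H) := rpow_pos_of_pos h0 _
  have hps : s ^ (2 * H) * s ^ (1 - 2 * H) = s := by
    rw [← rpow_add h0]
    simp
  have hws : s ^ (2 - 2 * H) = s * s ^ (1 - 2 * H) := by
    rw [rpow_eq_mul_rpow_sub_one h0 (2 - 2 * H)]
    ring_nf
  rw [fbmRatio, fbmCov, hws]
  have hle : 1 - (1 - s) ^ (2 * H) ≤ 2 * s := by nlinarith
  calc (s ^ (2 * H) + 1 - (1 - s) ^ (2 * H)) / 2 * s ^ (1 - 2 * H)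
      = s ^ (2 * H) * s ^ (1 - 2 * H) / 2 +
        (1 - (1 - s) ^ (2 * H)) * s ^ (1 - 2 * H) / 2 := by ring
    _ ≤ s / 2 + 2 * s * s ^ (1 - 2 * H) / 2 := by
        rw [hps]
        gcongr
    _ = _ := by ring

lemma tendsto_fbmRatio_zero {H : ℝ} (hH0 : 0 < H) (hH1 : H < 1) :
    Tendsto (fbmRatio H) (𝓝[>] 0) (𝓝 0) := by
  have hlim : Tendsto (fun s : ℝ => s / 2 + s ^ (2 - 2 * H)) (𝓝[>] 0) (𝓝 0) := by
    have hc : ContinuousAt (fun s : ℝ => s / 2 + s ^ (2 - 2 * H)) 0 :=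
      (continuousAt_id.div_const 2).add
        (continuousAt_rpow_const 0 (2 - 2 * H) (Or.inr (by linarith)))
    have h := hc.tendsto
    simp only [zero_div, zero_rpow (show 2 - 2 * H ≠ 0 by linarith), add_zero] at h
    exact h.mono_left nhdsWithin_le_nhds
  have hev : ∀ᶠ s : ℝ in 𝓝[>] 0, s ∈ Ioo (0 : ℝ) 1 := Ioo_mem_nhdsGT one_pos
  refine tendsto_of_tendsto_of_tendsto_of_le_of_le' tendsto_const_nhds hlim ?_ ?_
  · filter_upwards [hev] with s hs
    exact (mul_pos (fbmCov_pos hH0 hs.1 hs.2) (rpow_pos_of_pos hs.1 _)).le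
  · filter_upwards [hev] with s hs
    exact fbmRatio_le hH1 hs.1 hs.2

lemma tendsto_fbmRatio_one {H : ℝ} (hH0 : 0 < H) :
    Tendsto (fbmRatio H) (𝓝 1) (𝓝 1) := by
  have hp (m : ℝ) : ContinuousAt (fun s : ℝ => s ^ m) 1 :=
    continuousAt_rpow_const 1 m (Or.inl one_ne_zero)
  have hq : ContinuousAt (fun s : ℝ => (1 - s) ^ (2 * H)) 1 :=
    (continuousAt_const.sub continuousAt_id).rpow_const (Or.inr (by linarith))
  have hc : ContinuousAt (fbmRatio H) 1 :=
    ((((hp (2 * H)).add continuousAt_const).sub hq).div_const 2).mul (hp (1 - 2 * H))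
  have h := hc.tendsto
  have h1 : fbmRatio H 1 = 1 := by
    simp [fbmRatio, fbmCov, zero_rpow (show 2 * H ≠ 0 by linarith)]
  rwa [h1] at h

lemma tendsto_one_sub_nhdsGT_zero : Tendsto (fun s : ℝ => 1 - s) (𝓝[>] 0) (𝓝 1) := by
  have h : ContinuousAt (fun s : ℝ => 1 - s) 0 := by fun_prop
  simpa using h.tendsto.mono_left nhdsWithin_le_nhds

lemma tendsto_signFactor_nhdsGT_zero {H : ℝ} (hH0 : 0 < H) (hH1 : H < 1) (α : ℝ) :
    Tendsto (signFactor H α) (𝓝[>] 0) (𝓝 (-α)) := by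
  have hA := tendsto_fbmRatio_zero hH0 hH1
  have hB := (tendsto_fbmRatio_one hH0).comp tendsto_one_sub_nhdsGT_zero
  convert (((hA.sub hB).const_mul α).sub hB).add_const 1 using 2
  · rfl
  · ring

lemma tendsto_signFactor_one_sub {H : ℝ} (hH0 : 0 < H) (hH1 : H < 1) (α : ℝ) :
    Tendsto (fun s => signFactor H α (1 - s)) (𝓝[>] 0) (𝓝 (α + 1)) := by
  have hA := tendsto_fbmRatio_zero hH0 hH1
  have hB := (tendsto_fbmRatio_one hH0).comp tendsto_one_sub_nhdsGT_zero
  convert (((hB.sub hA).const_mul α).sub hA).add_const 1 using 2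
  · simp [signFactor]
  · ring

lemma exists_signFactor_eq_zero {H α : ℝ} (hH0 : 0 < H) (hH1 : H < 1) (hα : 0 < α) :
    ∃ s ∈ Ioo (0 : ℝ) 1, signFactor H α s = 0 := by
  have hev : ∀ᶠ s : ℝ in 𝓝[>] 0, s ∈ Ioo (0 : ℝ) 1 := Ioo_mem_nhdsGT one_pos
  obtain ⟨a, haneg, ha⟩ := (((tendsto_signFactor_nhdsGT_zero hH0 hH1 α).eventually_lt_const
    (neg_neg_of_pos hα)).and hev).exists
  obtain ⟨b, hbpos, hb⟩ := (((tendsto_signFactor_one_sub hH0 hH1 α).eventually_const_lt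
    (show (0 : ℝ) < α + 1 by linarith)).and hev).exists
  have hb' : 1 - b ∈ Ioo (0 : ℝ) 1 := ⟨by linarith [hb.2], by linarith [hb.1]⟩
  exact isPreconnected_Ioo.intermediate_value ha hb' (continuousOn_signFactor H α)
    ⟨haneg.le, hbpos.le⟩

lemma posFactor_pos {H α s : ℝ} (hH0 : 0 < H) (hH1 : H < 1) (hα : 0 < α)
    (h0 : 0 < s) (h1 : s < 1) : 0 < posFactor H α s := by
  have hf := fbmCov_pos hH0 h0 h1
  have hV := rpow_sub_fbmCov_sq_pos hH0 hH1 h0 h1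
  have hu : 0 < s ^ (2 * H - 1) := rpow_pos_of_pos h0 _
  have hv : 0 < (1 - s) ^ (2 * H - 1) := rpow_pos_of_pos (by linarith) _
  unfold posFactor
  positivity

lemma differentiableAt_posFactor {H s : ℝ} (hH0 : 0 < H) (hH1 : H < 1) (α : ℝ)
    (h0 : 0 < s) (h1 : s < 1) : DifferentiableAt ℝ (posFactor H α) s := by
  have hf := (hasDerivAt_fbmCov H h0 h1).differentiableAt
  have hp (m : ℝ) : DifferentiableAt ℝ (fun x : ℝ => x ^ m) s :=
    (hasDerivAt_rpow_const (Or.inl h0.ne')).differentiableAt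
  have hq := (hasDerivAt_one_sub_rpow h1 (2 * H - 1)).differentiableAt
  exact ((((hf.const_add α).const_mul (2 * H)).mul (hp _)).mul hq).div
    (((hp _).sub (hf.pow 2)).pow 2)
    (pow_ne_zero 2 (rpow_sub_fbmCov_sq_pos hH0 hH1 h0 h1).ne')

lemma hasDerivAt_genVariance {H s : ℝ} (hH0 : 0 < H) (hH1 : H < 1) (α : ℝ)
    (h0 : 0 < s) (h1 : s < 1) :
    HasDerivAt (fun x => (α + fbmCov H x) ^ 2 / (x ^ (2 * H) - fbmCov H x ^ 2) + 1)
      (posFactor H α s * signFactor H α s) s := by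
  have hs' : 0 < 1 - s := by linarith
  have hV := (rpow_sub_fbmCov_sq_pos hH0 hH1 h0 h1).ne'
  have hf := hasDerivAt_fbmCov H h0 h1
  have h := (((hf.const_add α).pow 2).div
    ((hasDerivAt_rpow_const (p := 2 * H) (Or.inl h0.ne')).sub (hf.pow 2)) hV).add_const 1
  refine h.congr_deriv ?_
  have hu : 0 < s ^ (2 * H - 1) := rpow_pos_of_pos h0 _
  have hv : 0 < (1 - s) ^ (2 * H - 1) := rpow_pos_of_pos hs' _
  have hu' : s ^ (1 - 2 * H) = (s ^ (2 * H - 1))⁻¹ := by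
    rw [← rpow_neg h0.le, neg_sub]
  have hv' : (1 - s) ^ (1 - 2 * H) = ((1 - s) ^ (2 * H - 1))⁻¹ := by
    rw [← rpow_neg hs'.le, neg_sub]
  have hfs : 2 * fbmCov H s = s ^ (2 * H) + 1 - (1 - s) ^ (2 * H) := by
    rw [fbmCov]
    ring
  rw [posFactor, signFactor, fbmRatio, fbmRatio, fbmCov_one_sub, hu', hv', div_mul_eq_mul_div]
  simp only [Pi.sub_apply, Pi.pow_apply]
  congr 1
  rw [rpow_eq_mul_rpow_sub_one h0 (2 * H)] at hfs ⊢
  rw [rpow_eq_mul_rpow_sub_one hs' (2 * H)] at hfs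
  set u := s ^ (2 * H - 1)
  set v := (1 - s) ^ (2 * H - 1)
  set F := fbmCov H s
  field_simp
  push_cast
  linear_combination (-2 * (α + F) * u) * hfs

/-- For `H ∈ (0,1)`, `α > 0`, `f(s) = (s^{2H} + 1 − (1−s)^{2H})/2` and
`D_α(s) = (α + f(s))²/(s^{2H} − f(s)²) + 1` on `(0,1)`: the denominator `s^{2H} − f(s)²` is
positive on `(0,1)`, `D_α` is twice differentiable on `(0,1)`, and `D_α` attains a unique
minimum at some `s* ∈ (0,1)`, with `D_α′ < 0` on `(0,s*)`, `D_α′ > 0` on `(s*,1)` and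
`D_α″(s*) > 0`. -/
theorem stmt_7 (H α : ℝ) (hH : H ∈ Set.Ioo (0 : ℝ) 1) (hα : 0 < α)
    (f D : ℝ → ℝ)
    (hf : ∀ s, f s = (s ^ (2 * H) + 1 - (1 - s) ^ (2 * H)) / 2)
    (hD : ∀ s, D s = (α + f s) ^ 2 / (s ^ (2 * H) - (f s) ^ 2) + 1) :
    (∀ s ∈ Set.Ioo (0 : ℝ) 1, 0 < s ^ (2 * H) - (f s) ^ 2) ∧
    (∀ s ∈ Set.Ioo (0 : ℝ) 1, DifferentiableAt ℝ D s ∧ DifferentiableAt ℝ (deriv D) s) ∧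
    ∃ s₀ ∈ Set.Ioo (0 : ℝ) 1,
      (∀ s ∈ Set.Ioo (0 : ℝ) 1, s ≠ s₀ → D s₀ < D s) ∧
      (∀ s ∈ Set.Ioo 0 s₀, deriv D s < 0) ∧
      (∀ s ∈ Set.Ioo s₀ 1, 0 < deriv D s) ∧
      0 < deriv (deriv D) s₀ := by
  obtain ⟨hH0, hH1⟩ := hH
  obtain rfl : f = fbmCov H := funext hf
  have hD' : ∀ s ∈ Ioo (0 : ℝ) 1,
      HasDerivAt D (posFactor H α s * signFactor H α s) s := fun s hs => by
    rw [show D = _ from funext hD]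
    exact hasDerivAt_genVariance hH0 hH1 α hs.1 hs.2
  have hD'' : ∀ s ∈ Ioo (0 : ℝ) 1, HasDerivAt (deriv D)
      (deriv (posFactor H α) s * signFactor H α s +
        posFactor H α s * deriv (signFactor H α) s) s := fun s hs => by
    have hprod := (differentiableAt_posFactor hH0 hH1 α hs.1 hs.2).hasDerivAt.mul
      (hasDerivAt_signFactor H α hs.1 hs.2).differentiableAt.hasDerivAt
    refine hprod.congr_of_eventuallyEq ?_
    filter_upwards [Ioo_mem_nhds hs.1 hs.2] with x hx
    exact (hD' x hx).deriv
  have hmono := strictMonoOn_signFactor hH0 hH1 hα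
  obtain ⟨s₀, hs₀, hzero⟩ := exists_signFactor_eq_zero hH0 hH1 hα
  have hneg : ∀ s ∈ Ioo 0 s₀, deriv D s < 0 := fun s hs => by
    have hs1 : s ∈ Ioo (0 : ℝ) 1 := ⟨hs.1, hs.2.trans hs₀.2⟩
    rw [(hD' s hs1).deriv]
    exact mul_neg_of_pos_of_neg (posFactor_pos hH0 hH1 hα hs1.1 hs1.2)
      (hzero ▸ hmono hs1 hs₀ hs.2)
  have hpos : ∀ s ∈ Ioo s₀ 1, 0 < deriv D s := fun s hs => by
    have hs1 : s ∈ Ioo (0 : ℝ) 1 := ⟨hs₀.1.trans hs.1, hs.2⟩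
    rw [(hD' s hs1).deriv]
    exact mul_pos (posFactor_pos hH0 hH1 hα hs1.1 hs1.2) (hzero ▸ hmono hs₀ hs1 hs.1)
  have hanti : StrictAntiOn D (Ioc 0 s₀) :=
    strictAntiOn_of_deriv_neg (convex_Ioc 0 s₀)
      (fun s hs => (hD' s ⟨hs.1, hs.2.trans_lt hs₀.2⟩).continuousAt.continuousWithinAt)
      (by simpa only [interior_Ioc] using hneg)
  have hincr : StrictMonoOn D (Ico s₀ 1) :=
    strictMonoOn_of_deriv_pos (convex_Ico s₀ 1)
      (fun s hs => (hD' s ⟨hs₀.1.trans_le hs.1, hs.2⟩).continuousAt.continuousWithinAt)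
      (by simpa only [interior_Ico] using hpos)
  refine ⟨fun s hs => rpow_sub_fbmCov_sq_pos hH0 hH1 hs.1 hs.2,
    fun s hs => ⟨(hD' s hs).differentiableAt, (hD'' s hs).differentiableAt⟩,
    s₀, hs₀, fun s hs hne => ?_, hneg, hpos, ?_⟩
  · rcases lt_or_gt_of_ne hne with h | h
    · exact hanti ⟨hs.1, h.le⟩ ⟨hs₀.1, le_rfl⟩ h
    · exact hincr ⟨le_rfl, hs₀.2⟩ ⟨h.le, hs.2⟩ h
  · rw [(hD'' s₀ hs₀).deriv, hzero, mul_zero, zero_add]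
    exact mul_pos (posFactor_pos hH0 hH1 hα hs₀.1 hs₀.2)
      (deriv_signFactor_pos hH0 hH1 hα hs₀.1 hs₀.2)
end

section
/- Let H ∈ (0,1), T > 0, t* ∈ (0,T), and r(t,s) = (t^{2H} + s^{2H} − |t−s|^{2H})/2. Define the 2×2-matrix-valued function R(t,s) = [[r(t₁,s₁), −r(t₁,s₂)],[−r(t₂,s₁), r(t₂,s₂)]] and Σ* = [[T^{2H}, −r(T,t*)],[−r(T,t*), t*^{2H}]]. Then, as (t,s) → (0,0) with t₁, s₁ ≤ 0 and t₂, s₂ ∈ ℝ, Σ* − R((T,t*) + t, (T,t*) + s) = A_{2,1}·t₁ + A_{1,2}·t₂ + A_{2,2}·t₂² + A_{2,1}ᵀ·s₁ + A_{1,2}ᵀ·s₂ + A_{2,2}ᵀ·s₂² + ½|t₁−s₁|^{2H}·E₁₁ + ½|t₂−s₂|^{2H}·E₂₂ + o(|t₁| + |s₁| + t₂² + s₂² + |t₁−s₁|^{2H} + |t₂−s₂|^{2H}), where A_{2,1} = H·[[−T^{2H−1}, T^{2H−1} − (T−t*)^{2H−1}],[0,0]], A_{1,2} = H·[[0,0],[t*^{2H−1}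 + (T−t*)^{2H−1}, −t*^{2H−1}]], A_{2,2} = H(H−½)·[[0,0],[t*^{2H−2} − (T−t*)^{2H−2}, −t*^{2H−2}]], E₁₁ = [[1,0],[0,0]], E₂₂ = [[0,0],[0,1]]. -/
open Real Matrix

/-- First-order Taylor expansion of `y ↦ y ^ p` at a point `a > 0`. -/
theorem exists_abs_rpow_add_sub_linear_le {a : ℝ} (ha : 0 < a) (p : ℝ) {ε : ℝ} (hε : 0 < ε) :
    ∃ δ > 0, ∀ x : ℝ, |x| < δ →
      |(a + x) ^ p - a ^ p - p * a ^ (p - 1) * x| ≤ ε * |x| := by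
  have h := (Real.hasDerivAt_rpow_const (x := a) (p := p) (Or.inl ha.ne')).isLittleO
  obtain ⟨δ, hδ, hb⟩ := Metric.eventually_nhds_iff.1 (h.def hε)
  refine ⟨δ, hδ, fun x hx => ?_⟩
  have := hb (y := a + x) (by simpa [Real.dist_eq] using hx)
  simpa [Real.norm_eq_abs, mul_comm, mul_left_comm] using this

/-- Second-order Taylor expansion of `y ↦ y ^ p` at a point `a > 0`. -/
theorem exists_abs_rpow_add_sub_quadratic_le {a : ℝ} (ha : 0 < a) (p : ℝ) {ε : ℝ}
    (hε : 0 < ε) :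
    ∃ δ > 0, ∀ x : ℝ, |x| < δ →
      |(a + x) ^ p - a ^ p - p * a ^ (p - 1) * x - p * (p - 1) / 2 * a ^ (p - 2) * x ^ 2|
        ≤ ε * x ^ 2 := by
  have hp : 0 < |p| + 1 := by positivity
  obtain ⟨δ, hδ, hb⟩ := exists_abs_rpow_add_sub_linear_le ha (p - 1) (div_pos hε hp)
  refine ⟨min δ a, lt_min hδ ha, fun x hx => ?_⟩
  have hderiv : ∀ y ∈ Set.Icc (-|x|) |x|, HasDerivWithinAt
      (fun y : ℝ => (a + y) ^ p - p * a ^ (p - 1) * y - p * (p - 1) / 2 * a ^ (p - 2) * y ^ 2)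
      (p * ((a + y) ^ (p - 1) - a ^ (p - 1) - (p - 1) * a ^ (p - 1 - 1) * y))
      (Set.Icc (-|x|) |x|) y := by
    intro y hy
    have hy' : |y| < a := (abs_le.2 hy).trans_lt (hx.trans_le (min_le_right _ _))
    have hpos : 0 < a + y := by linarith [neg_abs_le y]
    have h1 := ((hasDerivAt_id y).const_add a).rpow_const (p := p) (Or.inl hpos.ne')
    have h2 := ((h1.sub ((hasDerivAt_id y).const_mul (p * a ^ (p - 1)))).sub
      (((hasDerivAt_id y).pow 2).const_mul (p * (p - 1) / 2 * a ^ (p - 2)))).hasDerivWithinAt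
      (s := Set.Icc (-|x|) |x|)
    refine h2.congr_deriv ?_
    rw [show p - 1 - 1 = p - 2 by ring]
    simp
    ring
  have hbound : ∀ y ∈ Set.Icc (-|x|) |x|,
      ‖p * ((a + y) ^ (p - 1) - a ^ (p - 1) - (p - 1) * a ^ (p - 1 - 1) * y)‖ ≤ ε * |x| := by
    intro y hy
    have hy' : |y| ≤ |x| := abs_le.2 hy
    have h1 := hb y (hy'.trans_lt (hx.trans_le (min_le_left _ _)))
    rw [Real.norm_eq_abs, abs_mul]
    calc |p| * _ ≤ (|p| + 1) * (ε / (|p| + 1) * |x|) := by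
          gcongr
          · linarith
          · exact h1.trans (by gcongr)
      _ = ε * |x| := by field_simp
  have := (convex_Icc (-|x|) |x|).norm_image_sub_le_of_norm_hasDerivWithin_le hderiv hbound
    (x := 0) (y := x) (by simp) ⟨neg_abs_le x, le_abs_self x⟩
  simp only [Real.norm_eq_abs, sub_zero, add_zero, mul_zero, ne_eq, OfNat.ofNat_ne_zero,
    not_false_eq_true, zero_pow] at this
  rw [mul_assoc ε, abs_mul_abs_self, ← sq] at this
  refine le_trans (le_of_eq ?_) this
  congr 1
  ring

/-- Expansion of `(t, s) ↦ (a + t - s) ^ p` at the origin, to first order in `t` and to second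
order in `s`. -/
theorem exists_abs_rpow_add_sub_mixed_le {a : ℝ} (ha : 0 < a) (p : ℝ) {ε : ℝ} (hε : 0 < ε) :
    ∃ δ > 0, ∀ t s : ℝ, |t| < δ → |s| < δ →
      |(a + (t - s)) ^ p - a ^ p - p * a ^ (p - 1) * (t - s)
          - p * (p - 1) / 2 * a ^ (p - 2) * s ^ 2| ≤ ε * (|t| + s ^ 2) := by
  set c := p * (p - 1) / 2 * a ^ (p - 2) with hc
  obtain ⟨δ, hδ, hb⟩ := exists_abs_rpow_add_sub_quadratic_le ha p (half_pos (half_pos hε))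
  have hc1 : 0 < 6 * (|c| + 1) := by positivity
  refine ⟨min (δ / 2) (min 1 (ε / (6 * (|c| + 1)))),
    lt_min (half_pos hδ) (lt_min one_pos (div_pos hε hc1)), fun t s ht hs => ?_⟩
  simp only [lt_min_iff] at ht hs
  obtain ⟨ht1, ht2, ht3⟩ := ht
  obtain ⟨hs1, hs2, hs3⟩ := hs
  rw [lt_div_iff₀ hc1] at ht3 hs3
  have h1 := hb (t - s) (by linarith [abs_sub t s])
  have h2 : |c * (t ^ 2 - 2 * t * s)| ≤ ε / 2 * |t| := by
    rw [show c * (t ^ 2 - 2 * t * s) = c * (t - 2 * s) * t by ring, abs_mul, abs_mul]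
    gcongr
    have : |t - 2 * s| ≤ |t| + 2 * |s| := by
      simpa [abs_mul] using abs_sub t (2 * s)
    nlinarith [abs_nonneg c, abs_nonneg t, abs_nonneg s]
  have h3 : t ^ 2 ≤ |t| := by
    rw [← sq_abs]; nlinarith [abs_nonneg t]
  have h4 : (t - s) ^ 2 ≤ 2 * (|t| + s ^ 2) := by nlinarith [sq_nonneg (t + s)]
  rw [show (a + (t - s)) ^ p - a ^ p - p * a ^ (p - 1) * (t - s) - c * s ^ 2
      = ((a + (t - s)) ^ p - a ^ p - p * a ^ (p - 1) * (t - s) - c * (t - s) ^ 2)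
        + c * (t ^ 2 - 2 * t * s) by ring]
  refine (abs_add_le _ _).trans ?_
  nlinarith [mul_le_mul_of_nonneg_left h4 hε.le, mul_nonneg hε.le (sq_nonneg s)]

/-- Second-order expansion of the fBm bivariate covariance
`R(t,s) = [[r(t₁,s₁), −r(t₁,s₂)],[−r(t₂,s₁), r(t₂,s₂)]]`, with
`r(t,s) = (t^{2H} + s^{2H} − |t−s|^{2H})/2`, around the point `(T,t*)` (approached with
`t₁,s₁ ≤ 0` and `t₂,s₂ ∈ ℝ`), as stated in the paper's fBm double-crossing lemma. -/
theorem stmt_10 (H T tstar : ℝ) (hH : H ∈ Set.Ioo (0 : ℝ) 1) (hT : 0 < T)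
    (htstar : tstar ∈ Set.Ioo (0 : ℝ) T)
    (r : ℝ → ℝ → ℝ)
    (hr : ∀ t s, r t s = (t ^ (2 * H) + s ^ (2 * H) - |t - s| ^ (2 * H)) / 2)
    (R : ℝ × ℝ → ℝ × ℝ → Matrix (Fin 2) (Fin 2) ℝ)
    (hR : ∀ t s : ℝ × ℝ, R t s =
      !![r t.1 s.1, -r t.1 s.2; -r t.2 s.1, r t.2 s.2])
    (Sigstar : Matrix (Fin 2) (Fin 2) ℝ)
    (hSigstar : Sigstar = !![T ^ (2 * H), -r T tstar; -r T tstar, tstar ^ (2 * H)])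
    (A21 A12 A22 : Matrix (Fin 2) (Fin 2) ℝ)
    (hA21 : A21 = H • !![-T ^ (2 * H - 1), T ^ (2 * H - 1) - (T - tstar) ^ (2 * H - 1); 0, 0])
    (hA12 : A12 = H • !![0, 0; tstar ^ (2 * H - 1) + (T - tstar) ^ (2 * H - 1),
      -tstar ^ (2 * H - 1)])
    (hA22 : A22 = (H * (H - 1 / 2)) •
      !![0, 0; tstar ^ (2 * H - 2) - (T - tstar) ^ (2 * H - 2), -tstar ^ (2 * H - 2)]) :
    ∀ ε > (0 : ℝ), ∃ δ > (0 : ℝ), ∀ t₁ t₂ s₁ s₂ : ℝ,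
      t₁ ≤ 0 → s₁ ≤ 0 → |t₁| < δ → |t₂| < δ → |s₁| < δ → |s₂| < δ →
      ∀ p q : Fin 2,
        |(Sigstar - R (T + t₁, tstar + t₂) (T + s₁, tstar + s₂)
            - (t₁ • A21 + t₂ • A12 + (t₂ ^ 2) • A22
               + s₁ • A21ᵀ + s₂ • A12ᵀ + (s₂ ^ 2) • A22ᵀ
               + (|t₁ - s₁| ^ (2 * H) / 2) • !![1, 0; 0, 0]
               + (|t₂ - s₂| ^ (2 * H) / 2) • !![0, 0; 0, 1])
            : Matrix (Fin 2) (Fin 2) ℝ) p q|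
          ≤ ε * (|t₁| + |s₁| + t₂ ^ 2 + s₂ ^ 2 + |t₁ - s₁| ^ (2 * H) + |t₂ - s₂| ^ (2 * H)) := by
  obtain ⟨hts0, htsT⟩ := htstar
  have hd0 : 0 < T - tstar := sub_pos.2 htsT
  intro ε hε
  obtain ⟨δ₁, hδ₁, hT1⟩ := exists_abs_rpow_add_sub_linear_le hT (2 * H) hε
  obtain ⟨δ₂, hδ₂, hS2⟩ := exists_abs_rpow_add_sub_quadratic_le hts0 (2 * H) hε
  obtain ⟨δ₃, hδ₃, hD⟩ := exists_abs_rpow_add_sub_mixed_le hd0 (2 * H) hε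
  refine ⟨min δ₁ (min δ₂ (min δ₃ ((T - tstar) / 2))),
    lt_min hδ₁ (lt_min hδ₂ (lt_min hδ₃ (half_pos hd0))), fun t₁ t₂ s₁ s₂ _ _ ht₁ ht₂ hs₁ hs₂ => ?_⟩
  simp only [lt_min_iff] at ht₁ ht₂ hs₁ hs₂
  have hTt := abs_le.1 (hT1 t₁ ht₁.1)
  have hTs := abs_le.1 (hT1 s₁ hs₁.1)
  have hSt := abs_le.1 (hS2 t₂ ht₂.2.1)
  have hSs := abs_le.1 (hS2 s₂ hs₂.2.1)
  have hDt := abs_le.1 (hD t₁ s₂ ht₁.2.2.1 hs₂.2.2.1)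
  have hDs := abs_le.1 (hD s₁ t₂ hs₁.2.2.1 ht₂.2.2.1)
  have habs : |T - tstar| = T - tstar := abs_of_pos hd0
  have habs_t : |T + t₁ - (tstar + s₂)| = T - tstar + (t₁ - s₂) := by
    rw [abs_of_pos] <;> linarith [neg_abs_le t₁, le_abs_self s₂]
  have habs_s : |tstar + t₂ - (T + s₁)| = T - tstar + (s₁ - t₂) := by
    rw [abs_sub_comm, abs_of_pos] <;> linarith [neg_abs_le s₁, le_abs_self t₂]
  have n₁ := mul_nonneg hε.le (abs_nonneg t₁)
  have n₂ := mul_nonneg hε.le (abs_nonneg s₁)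
  have n₃ := mul_nonneg hε.le (sq_nonneg t₂)
  have n₄ := mul_nonneg hε.le (sq_nonneg s₂)
  have n₅ := mul_nonneg hε.le (Real.rpow_nonneg (abs_nonneg (t₁ - s₁)) (2 * H))
  have n₆ := mul_nonneg hε.le (Real.rpow_nonneg (abs_nonneg (t₂ - s₂)) (2 * H))
  subst hA21 hA12 hA22 hSigstar
  intro p q
  fin_cases p <;> fin_cases q <;>
    simp [hR, hr, habs, habs_t, habs_s] <;>
    rw [abs_le] <;> constructor <;> linarith
end

section
/- Let Σ be an invertible real d×d matrix, n ≥ 1, and let β′, β ∈ ℝⁿ satisfy 0 < β′ < β ≤ 2β′ componentwise; set F = {i : 2β′ᵢ = βᵢ}. Let B_{1,i}, B_{2,i} (1 ≤ i ≤ n) and A_{6,i,j} (i, j ∈ F) be real d×d matrices, and suppose a d×d-matrix-valued function Σ(·) on a neighborhood of 0 in [0,∞)ⁿ satisfies Σ − Σ(t) = Σᵢ[B_{1,i}tᵢ^{β′ᵢ} + B_{2,i}tᵢ^{βᵢ}] + Σ_{i,j∈F} A_{6,i,j}tᵢ^{βᵢ/2}tⱼ^{βⱼ/2} + o(Σᵢ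 tᵢ^{βᵢ}) as t ↓ 0. Then Σ(t) is invertible for all t sufficiently close to 0, and Σ(t)⁻¹ − Σ⁻¹ = Σ⁻¹·[Σᵢ(B_{1,i}tᵢ^{β′ᵢ} + B_{2,i}tᵢ^{βᵢ}) + Σ_{i,j∈F}(A_{6,i,j} + B_{1,i}Σ⁻¹B_{1,j})·tᵢ^{βᵢ/2}tⱼ^{βⱼ/2}]·Σ⁻¹ + o(Σᵢ tᵢ^{βᵢ}) as t ↓ 0. -/
open Real Matrix

open Filter Topology Asymptotics

attribute [local instance] Matrix.linftyOpNormedRing Matrix.linftyOpNormedAlgebra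

/-- Neighbourhoods of the origin in the orthant `[0,∞)ⁿ`. -/
theorem eventually_nhdsWithin_orthant_iff {n : ℕ} {P : (Fin n → ℝ) → Prop} :
    (∀ᶠ t in 𝓝[{t : Fin n → ℝ | ∀ i, 0 ≤ t i}] 0, P t) ↔
      ∃ δ > (0 : ℝ), ∀ t : Fin n → ℝ, (∀ i, 0 ≤ t i) → (∀ i, t i < δ) → P t := by
  rw [eventually_nhdsWithin_iff, Metric.eventually_nhds_iff]
  refine exists_congr fun δ => and_congr_right fun hδ => forall_congr' fun t => ?_
  rw [dist_pi_lt_iff hδ]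
  constructor
  · intro h h0 hlt
    exact h (fun i => by simpa [abs_of_nonneg (h0 i)] using hlt i) h0
  · intro h hlt h0
    exact h h0 fun i => by simpa [abs_of_nonneg (h0 i)] using hlt i

/-- A matrix-valued function is `o(g)` iff all its entries are. -/
theorem Matrix.isLittleO_iff_entries {α : Type*} {d : ℕ} {l : Filter α}
    {f : α → Matrix (Fin d) (Fin d) ℝ} {g : α → ℝ} :
    f =o[l] g ↔ ∀ p q, (fun t => f t p q) =o[l] g := by
  constructor
  · intro h p q
    exact ((LinearMap.toContinuousLinearMap
      (Matrix.entryLinearMap ℝ ℝ p q)).isBigO_comp f l).trans_isLittleO h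
  · intro h
    have key : f = fun t => ∑ p, ∑ q, f t p q • Matrix.single p q (1 : ℝ) := by
      funext t
      conv_lhs => rw [Matrix.matrix_eq_sum_single (f t)]
      simp [Matrix.smul_single]
    rw [key]
    refine IsLittleO.fun_sum fun p _ => IsLittleO.fun_sum fun q _ => ?_
    have hc : (fun _ : α => Matrix.single p q (1 : ℝ)) =O[l] fun _ => (1 : ℝ) :=
      isBigO_const_const _ one_ne_zero _
    simpa using (h p q).smul_isBigO hc

/-- Entrywise `ε`-`δ` form of `f = o(g)` at the origin of the orthant. -/
theorem Matrix.isLittleO_orthant_iff {d n : ℕ}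
    {f : (Fin n → ℝ) → Matrix (Fin d) (Fin d) ℝ} {g : (Fin n → ℝ) → ℝ}
    (hg : ∀ t, (∀ i, 0 ≤ t i) → 0 ≤ g t) :
    f =o[𝓝[{t : Fin n → ℝ | ∀ i, 0 ≤ t i}] 0] g ↔
      ∀ ε > (0 : ℝ), ∃ δ > (0 : ℝ), ∀ t : Fin n → ℝ,
        (∀ i, 0 ≤ t i) → (∀ i, t i < δ) → ∀ p q : Fin d, |f t p q| ≤ ε * g t := by
  simp_rw [← eventually_nhdsWithin_orthant_iff, Matrix.isLittleO_iff_entries, isLittleO_iff,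
    eventually_all]
  have hnorm : ∀ ε p q, (∀ᶠ t in 𝓝[{t : Fin n → ℝ | ∀ i, 0 ≤ t i}] 0,
      ‖f t p q‖ ≤ ε * ‖g t‖) ↔
      ∀ᶠ t in 𝓝[{t : Fin n → ℝ | ∀ i, 0 ≤ t i}] 0, |f t p q| ≤ ε * g t := by
    intro ε p q
    refine eventually_congr ?_
    filter_upwards [self_mem_nhdsWithin] with t ht
    rw [Real.norm_eq_abs, Real.norm_eq_abs, abs_of_nonneg (hg t ht)]
  simp_rw [hnorm]
  exact ⟨fun h ε hε p q => h p q hε, fun h p q ε hε => h ε hε p q⟩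

/-- Second-order expansion of the inverse at a unit, along a perturbation that is `O(r)`. -/
theorem NormedRing.inverse_sub_isLittleO {α R : Type*} [NormedRing R] [CompleteSpace R]
    {l : Filter α} {r : α → ℝ} (hr : Tendsto r l (𝓝 0)) {a : R} (ha : IsUnit a)
    {S M : α → R} (hM : M =O[l] r) (hSM : (fun t => a - S t - M t) =o[l] r) :
    (∀ᶠ t in l, IsUnit (S t)) ∧
      (fun t => Ring.inverse (S t) - Ring.inverse a - Ring.inverse a *
        (a - S t + M t * Ring.inverse a * M t) * Ring.inverse a) =o[l] fun t => r t ^ 2 := by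
  have hD : (fun t => a - S t) =O[l] r := by
    simpa using hSM.isBigO.add hM
  have hS : Tendsto S l (𝓝 a) := by
    simpa using (hD.trans_tendsto hr).const_sub a
  have hunit : ∀ᶠ t in l, IsUnit (S t) := hS.eventually (Units.isOpen.mem_nhds ha)
  refine ⟨hunit, ?_⟩
  have hinv : (fun t => Ring.inverse (S t)) =O[l] fun _ => (1 : ℝ) := by
    obtain ⟨u, rfl⟩ := ha
    exact ((NormedRing.inverse_continuousAt u).tendsto.comp hS).isBigO_one ℝ
  set b := Ring.inverse a with hb
  have hb1 : (fun _ : α => b) =O[l] fun _ => (1 : ℝ) := isBigO_const_const _ one_ne_zero _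
  have hr1 : r =o[l] fun _ => (1 : ℝ) := (isLittleO_one_iff ℝ).2 hr
  have h1 := (((hb1.mul_isLittleO hSM).mul_isBigO hb1).mul_isBigO hD).mul_isBigO hb1
  have h2 := (((hb1.mul hM).mul hb1).mul_isLittleO hSM).mul_isBigO hb1
  have h3 := (((((hinv.mul hD).mul hb1).mul hD).mul hb1).mul_isLittleO
    (hD.trans_isLittleO hr1)).mul_isBigO hb1
  have hsum := (h1.add (h2.congr_right fun t => by ring)).add (h3.congr_right fun t => by ring)
  refine hsum.congr' ?_ (Eventually.of_forall fun t => by ring)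
  filter_upwards [hunit] with t ht
  have hres : Ring.inverse (S t) = b + Ring.inverse (S t) * (a - S t) * b := by
    rw [mul_sub, sub_mul, Ring.inverse_mul_cancel _ ht, mul_assoc, hb,
      Ring.mul_inverse_cancel _ ha]
    simp
  generalize Ring.inverse (S t) = x at hres ⊢
  have hexpand : x = b + b * (a - S t) * b + b * (a - S t) * b * (a - S t) * b
      + x * (a - S t) * b * (a - S t) * b * (a - S t) * b := by
    generalize a - S t = D at hres ⊢
    calc x = b + (b + (b + x * D * b) * D * b) * D * b := by rw [← hres, ← hres, ← hres]
      _ = _ := by noncomm_ring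
  conv_rhs => rw [hexpand]
  generalize a - S t = D
  noncomm_ring

/-- Neumann-series expansion of the inverse: if
`Σ − Σ(t) = Σᵢ[B_{1,i}tᵢ^{β′ᵢ} + B_{2,i}tᵢ^{βᵢ}] + Σ_{i,j∈F}A_{6,i,j}tᵢ^{βᵢ/2}tⱼ^{βⱼ/2}
+ o(Σᵢ tᵢ^{βᵢ})` as `t ↓ 0`, with `0 < β′ < β ≤ 2β′` and `F = {i : 2β′ᵢ = βᵢ}`, then `Σ(t)`
is invertible near `0` and `Σ(t)⁻¹ − Σ⁻¹ = Σ⁻¹[Σᵢ(B_{1,i}tᵢ^{β′ᵢ} + B_{2,i}tᵢ^{βᵢ})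
+ Σ_{i,j∈F}(A_{6,i,j} + B_{1,i}Σ⁻¹B_{1,j})tᵢ^{βᵢ/2}tⱼ^{βⱼ/2}]Σ⁻¹ + o(Σᵢ tᵢ^{βᵢ})`. -/
theorem stmt_11 {d n : ℕ} (hd : 1 ≤ d) (hn : 1 ≤ n)
    (Sig : Matrix (Fin d) (Fin d) ℝ) (hSig : IsUnit Sig)
    (β' β : Fin n → ℝ) (hβ'pos : ∀ i, 0 < β' i)
    (hββ' : ∀ i, β' i < β i ∧ β i ≤ 2 * β' i)
    (F : Finset (Fin n)) (hF : ∀ i, i ∈ F ↔ 2 * β' i = β i)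
    (B1 B2 : Fin n → Matrix (Fin d) (Fin d) ℝ)
    (A6 : Fin n → Fin n → Matrix (Fin d) (Fin d) ℝ)
    (Sfun : (Fin n → ℝ) → Matrix (Fin d) (Fin d) ℝ)
    (hexp : ∀ ε > (0 : ℝ), ∃ δ > (0 : ℝ), ∀ t : Fin n → ℝ,
      (∀ i, 0 ≤ t i) → (∀ i, t i < δ) → ∀ p q : Fin d,
        |(Sig - Sfun t
            - (∑ i, ((t i ^ β' i) • B1 i + (t i ^ β i) • B2 i)
               + ∑ i ∈ F, ∑ j ∈ F, (t i ^ (β i / 2) * t j ^ (β j / 2)) • A6 i j)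
            : Matrix (Fin d) (Fin d) ℝ) p q|
          ≤ ε * ∑ i, t i ^ β i) :
    (∃ δ₀ > (0 : ℝ), ∀ t : Fin n → ℝ, (∀ i, 0 ≤ t i) → (∀ i, t i < δ₀) →
      IsUnit (Sfun t)) ∧
    ∀ ε > (0 : ℝ), ∃ δ > (0 : ℝ), ∀ t : Fin n → ℝ,
      (∀ i, 0 ≤ t i) → (∀ i, t i < δ) → ∀ p q : Fin d,
        |((Sfun t)⁻¹ - Sig⁻¹
            - Sig⁻¹ * (∑ i, ((t i ^ β' i) • B1 i + (t i ^ β i) • B2 i)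
               + ∑ i ∈ F, ∑ j ∈ F, (t i ^ (β i / 2) * t j ^ (β j / 2)) •
                   (A6 i j + B1 i * Sig⁻¹ * B1 j)) * Sig⁻¹
            : Matrix (Fin d) (Fin d) ℝ) p q|
          ≤ ε * ∑ i, t i ^ β i := by
  set l : Filter (Fin n → ℝ) := 𝓝[{t : Fin n → ℝ | ∀ i, 0 ≤ t i}] 0
  set s : (Fin n → ℝ) → ℝ := fun t => ∑ i, t i ^ β i
  have hβpos : ∀ i, 0 < β i := fun i => (hβ'pos i).trans (hββ' i).1
  have hs0 : ∀ t : Fin n → ℝ, (∀ i, 0 ≤ t i) → 0 ≤ s t := fun t ht =>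
    Finset.sum_nonneg fun i _ => rpow_nonneg (ht i) _
  have hnonneg : ∀ᶠ t in l, ∀ i, 0 ≤ t i := self_mem_nhdsWithin
  have hcoord : ∀ i, Tendsto (fun t : Fin n → ℝ => t i) l (𝓝 0) := fun i =>
    tendsto_nhdsWithin_of_tendsto_nhds ((continuous_apply i).tendsto 0)
  have hpow : ∀ i (c : ℝ), 0 < c → (fun t : Fin n → ℝ => t i ^ c) =o[l] fun _ => (1 : ℝ) := by
    intro i c hc
    rw [isLittleO_one_iff]
    simpa [zero_rpow hc.ne'] using (hcoord i).rpow_const (Or.inr hc.le)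
  have hrtend : Tendsto (fun t => √(s t)) l (𝓝 0) := by
    have h : Tendsto s l (𝓝 0) := by
      simpa using tendsto_finsetSum Finset.univ fun i _ =>
        (isLittleO_one_iff ℝ).1 (hpow i (β i) (hβpos i))
    simpa using h.sqrt
  have hsq : (fun t => √(s t) ^ 2) =ᶠ[l] s := by
    filter_upwards [hnonneg] with t ht using sq_sqrt (hs0 t ht)
  have hhalf : ∀ i, (fun t : Fin n → ℝ => t i ^ (β i / 2)) =O[l] fun t => √(s t) := by
    intro i
    refine IsBigO.of_bound 1 ?_
    filter_upwards [hnonneg] with t ht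
    rw [one_mul, norm_of_nonneg (rpow_nonneg (ht i) _), norm_of_nonneg (sqrt_nonneg _)]
    refine le_sqrt_of_sq_le ?_
    rw [← rpow_natCast, ← rpow_mul (ht i)]
    simpa using Finset.single_le_sum (f := fun i => t i ^ β i)
      (fun j _ => rpow_nonneg (ht j) _) (Finset.mem_univ i)
  have hsmall : ∀ i (c : ℝ), β i / 2 < c →
      (fun t : Fin n → ℝ => t i ^ c) =o[l] fun t => √(s t) := by
    intro i c hc
    have h := (hpow i (c - β i / 2) (sub_pos.2 hc)).mul_isBigO (hhalf i)
    refine h.congr' ?_ (Eventually.of_forall fun t => one_mul _)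
    filter_upwards [hnonneg] with t ht
    rw [← rpow_add_of_nonneg (ht i) (sub_pos.2 hc).le (half_pos (hβpos i)).le, sub_add_cancel]
  have hconst : ∀ A : Matrix (Fin d) (Fin d) ℝ,
      (fun _ : Fin n → ℝ => A) =O[l] fun _ => (1 : ℝ) :=
    fun A => isBigO_const_const _ one_ne_zero _
  have hsmulo : ∀ {f : (Fin n → ℝ) → ℝ} (A : Matrix (Fin d) (Fin d) ℝ),
      f =o[l] (fun t => √(s t)) → (fun t => f t • A) =o[l] fun t => √(s t) :=
    fun A hf => by simpa using hf.smul_isBigO (hconst A)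
  set M : (Fin n → ℝ) → Matrix (Fin d) (Fin d) ℝ :=
    fun t => ∑ i ∈ F, t i ^ (β i / 2) • B1 i with hMdef
  set L : (Fin n → ℝ) → Matrix (Fin d) (Fin d) ℝ :=
    fun t => ∑ i, ((t i ^ β' i) • B1 i + (t i ^ β i) • B2 i) with hLdef
  set Q : (Fin n → ℝ) → Matrix (Fin d) (Fin d) ℝ :=
    fun t => ∑ i ∈ F, ∑ j ∈ F, (t i ^ (β i / 2) * t j ^ (β j / 2)) • A6 i j with hQdef
  have hM : M =O[l] fun t => √(s t) :=
    IsBigO.fun_sum fun i _ => by simpa using (hhalf i).smul (hconst (B1 i))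
  have hLM : (fun t => L t - M t) =o[l] fun t => √(s t) := by
    have hterm : ∀ t, L t - M t = ∑ i, ((t i ^ β' i - if i ∈ F then t i ^ (β i / 2) else 0) • B1 i
        + (t i ^ β i) • B2 i) := by
      intro t
      have hMt : M t = ∑ i, (if i ∈ F then t i ^ (β i / 2) else 0) • B1 i := by
        simp [hMdef, ite_smul, Finset.sum_ite_mem]
      rw [hMt, hLdef, ← Finset.sum_sub_distrib]
      exact Finset.sum_congr rfl fun i _ => by rw [sub_smul]; abel
    simp_rw [hterm]
    refine IsLittleO.fun_sum fun i _ => (hsmulo _ ?_).add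
      (hsmulo _ (hsmall i (β i) (half_lt_self (hβpos i))))
    by_cases hi : i ∈ F
    · have h : β' i = β i / 2 := by linarith [(hF i).1 hi]
      simp [hi, h]
    · have h : β i / 2 < β' i := by
        have := lt_of_le_of_ne (hββ' i).2 fun h => hi ((hF i).2 h.symm)
        linarith
      simpa [hi] using hsmall i (β' i) h
  have hQ : Q =o[l] fun t => √(s t) := by
    refine IsLittleO.fun_sum fun i _ => IsLittleO.fun_sum fun j _ => hsmulo _ ?_
    simpa using (hpow i (β i / 2) (half_pos (hβpos i))).mul_isBigO (hhalf j)
  have hE : (fun t => Sig - Sfun t - (L t + Q t)) =o[l] s :=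
    (Matrix.isLittleO_orthant_iff hs0).2 hexp
  have hsr : s =O[l] fun t => √(s t) := by
    have h := (((isLittleO_one_iff ℝ).2 hrtend).mul_isBigO
      (isBigO_refl (fun t => √(s t)) l)).isBigO
    refine h.congr' ?_ (Eventually.of_forall fun t => one_mul _)
    filter_upwards [hsq] with t ht
    rw [← sq, ht]
  have hSM : (fun t => Sig - Sfun t - M t) =o[l] fun t => √(s t) :=
    (((hE.trans_isBigO hsr).add hQ).add hLM).congr_left fun t => by abel
  obtain ⟨hunit, hmain⟩ := NormedRing.inverse_sub_isLittleO hrtend hSig hM hSM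
  refine ⟨eventually_nhdsWithin_orthant_iff.1 hunit, (Matrix.isLittleO_orthant_iff hs0).1 ?_⟩
  have hE' : (fun t => Sig⁻¹ * (Sig - Sfun t - (L t + Q t)) * Sig⁻¹) =o[l] s := by
    simpa using ((hconst Sig⁻¹).mul_isLittleO hE).mul_isBigO (hconst Sig⁻¹)
  refine ((hmain.trans_eventuallyEq hsq).add hE').congr_left fun t => ?_
  have hquad : (∑ i ∈ F, ∑ j ∈ F, (t i ^ (β i / 2) * t j ^ (β j / 2)) •
      (A6 i j + B1 i * Sig⁻¹ * B1 j)) = Q t + M t * Sig⁻¹ * M t := by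
    simp only [hQdef, hMdef, smul_add, Finset.sum_add_distrib, Finset.sum_mul, Finset.mul_sum,
      Finset.smul_sum, smul_mul_assoc, mul_smul_comm, smul_smul]
    rw [add_right_inj, Finset.sum_comm]
    exact Finset.sum_congr rfl fun _ _ => Finset.sum_congr rfl fun _ _ => by rw [mul_comm]
  rw [hquad, ← Matrix.nonsing_inv_eq_ringInverse, ← Matrix.nonsing_inv_eq_ringInverse]
  noncomm_ring
end

section
/- Under the kernel expansion hypotheses below, the conditional-mean vector d_τ(t) := [I − R(τ + t, τ)·Σ(τ)⁻¹]·b satisfies, as (τ, t) ↓ (0, 0) in [0,∞)ⁿ × [0,∞)ⁿ, d_τ(t) = Σᵢ[A_{2,i}·((τᵢ + tᵢ)^{βᵢ} − τᵢ^{βᵢ}) + S_{αᵢ,A_{5,i}}(tᵢ)]·w + Σ_{i,j∈F} τⱼ^{βⱼ/2}·((τᵢ + tᵢ)^{βᵢ/2} − τᵢ^{βᵢ/2})·D_{i,j}·w + o(Σᵢ[τᵢ^{βᵢ} + tᵢ^{βᵢ} + |tᵢ|^{αᵢ}]). -/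
open Real Matrix

/-- `S_{α,V}(u) = |u|^α (V·1_{u≥0} + Vᵀ·1_{u<0})`. -/
noncomputable def Smat {d : ℕ} (a : ℝ) (V : Matrix (Fin d) (Fin d) ℝ) (u : ℝ) :
    Matrix (Fin d) (Fin d) ℝ :=
  |u| ^ a • (if 0 ≤ u then V else Vᵀ)

open Asymptotics Filter Topology

section MatrixAsymptotics

attribute [local instance] Matrix.linftyOpNormedRing Matrix.linftyOpNormedAlgebra

variable {d : ℕ} {X ι : Type*} {l : Filter X}

theorem Matrix.isLittleO_of_entries {M : X → Matrix (Fin d) (Fin d) ℝ} {g : X → ℝ}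
    (h : ∀ p q, (fun x => M x p q) =o[l] g) : M =o[l] g := by
  have hM : M = fun x => ∑ p, ∑ q, M x p q • Matrix.single p q (1 : ℝ) := by
    funext x
    conv_lhs => rw [Matrix.matrix_eq_sum_single (M x)]
    simp [Matrix.smul_single]
  rw [hM]
  refine IsLittleO.fun_sum fun p _ => IsLittleO.fun_sum fun q _ => ?_
  simpa using (h p q).smul_isBigO
    (isBigO_const_const (Matrix.single p q (1 : ℝ)) (one_ne_zero (α := ℝ)) l)

theorem Matrix.isBigO_mulVec {M : X → Matrix (Fin d) (Fin d) ℝ} {v : X → Fin d → ℝ}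
    {f g : X → ℝ} (hM : M =O[l] f) (hv : v =O[l] g) :
    (fun x => M x *ᵥ v x) =O[l] fun x => f x * g x :=
  (IsBigO.of_norm_le fun x => Matrix.linfty_opNorm_mulVec (M x) (v x)).trans
    (hM.norm_left.mul hv.norm_left)

theorem Matrix.isLittleO_mulVec {M : X → Matrix (Fin d) (Fin d) ℝ} {v : X → Fin d → ℝ}
    {f g : X → ℝ} (hM : M =o[l] f) (hv : v =O[l] g) :
    (fun x => M x *ᵥ v x) =o[l] fun x => f x * g x :=
  (IsBigO.of_norm_le fun x => Matrix.linfty_opNorm_mulVec (M x) (v x)).trans_isLittleO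
    (hM.norm_left.mul_isBigO hv.norm_left)

theorem Asymptotics.IsBigO.smul_const_matrix {c g : X → ℝ} (h : c =O[l] g)
    (A : Matrix (Fin d) (Fin d) ℝ) : (fun x => c x • A) =O[l] g := by
  simpa using h.smul (isBigO_const_const A (one_ne_zero (α := ℝ)) l)

theorem Asymptotics.IsBigO.smul_const_vec {c g : X → ℝ} (h : c =O[l] g)
    (v : Fin d → ℝ) : (fun x => c x • v) =O[l] g := by
  simpa using h.smul (isBigO_const_const v (one_ne_zero (α := ℝ)) l)

theorem Asymptotics.IsLittleO.smul_const_vec {c g : X → ℝ} (h : c =o[l] g)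
    (v : Fin d → ℝ) : (fun x => c x • v) =o[l] g := by
  simpa using h.smul_isBigO (isBigO_const_const v (one_ne_zero (α := ℝ)) l)

/-- If `h → 0`, `K = Sig - ∑ cᵢ (Aᵢ + Aᵢᵀ) + O(h²)` and `Aᵢ Sig⁻¹ b = 0`, then
`K⁻¹ b = w + ∑ⱼ cⱼ Sig⁻¹ Aⱼᵀ w + O(h²)` with `w = Sig⁻¹ b`. -/
theorem Matrix.inv_mulVec_expansion [Fintype ι] {h : X → ℝ} (hh : Tendsto h l (𝓝 0))
    {Sig : Matrix (Fin d) (Fin d) ℝ} (hSig : IsUnit Sig)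
    {K Q : X → Matrix (Fin d) (Fin d) ℝ} (hK : ∀ᶠ x in l, IsUnit (K x))
    {A : ι → Matrix (Fin d) (Fin d) ℝ} {c : ι → X → ℝ} (hc : ∀ i, c i =O[l] h)
    (hKQ : ∀ᶠ x in l, Sig - K x = ∑ i, c i x • (A i + (A i)ᵀ) + Q x)
    (hQ : Q =O[l] fun x => h x * h x)
    {b w : Fin d → ℝ} (hw : w = Sig⁻¹ *ᵥ b) (hAw : ∀ i, A i *ᵥ w = 0) :
    (fun x => (K x)⁻¹ *ᵥ b - w - ∑ j, c j x • (Sig⁻¹ *ᵥ ((A j)ᵀ *ᵥ w)))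
      =O[l] fun x => h x * h x := by
  have hh1 : h =o[l] fun _ => (1 : ℝ) := (isLittleO_one_iff ℝ).2 hh
  have hhh : (fun x => h x * h x) =O[l] h := by
    simpa using (isBigO_refl h l).mul hh1.isBigO
  have hE : (fun x => Sig - K x) =O[l] h :=
    ((IsBigO.fun_sum fun i _ => (hc i).smul_const_matrix _).add (hQ.trans hhh)).congr'
      (hKQ.mono fun x hx => hx.symm) EventuallyEq.rfl
  have hES : (fun x => Sig⁻¹ * (Sig - K x)) =O[l] h := by
    simpa using (isBigO_const_const Sig⁻¹ (one_ne_zero (α := ℝ)) l).mul hE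
  have hSd := (Matrix.isUnit_iff_isUnit_det _).1 hSig
  have hv : ∀ᶠ x in l, (K x)⁻¹ *ᵥ b - w = (Sig⁻¹ * (Sig - K x)) *ᵥ ((K x)⁻¹ *ᵥ b) := by
    filter_upwards [hK] with x hx
    have hd := (Matrix.isUnit_iff_isUnit_det _).1 hx
    rw [mul_sub, Matrix.nonsing_inv_mul _ hSd, sub_mulVec, one_mulVec, ← mulVec_mulVec,
      mulVec_mulVec (M := K x), Matrix.mul_nonsing_inv _ hd, one_mulVec, hw]
  have hvb : (fun x => (K x)⁻¹ *ᵥ b) =O[l] fun _ => (1 : ℝ) := by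
    have h1 : (fun x => (K x)⁻¹ *ᵥ b - w) =o[l] fun x => ‖(K x)⁻¹ *ᵥ b‖ := by
      refine IsLittleO.congr' (Matrix.isLittleO_mulVec (hES.trans_isLittleO hh1)
        (isBigO_refl (fun x => (K x)⁻¹ *ᵥ b) l).norm_right) (hv.mono fun x hx => hx.symm) ?_
      exact Eventually.of_forall fun x => by simp
    have h2 := h1.of_norm_right.right_isBigO_sub
    simp only [sub_sub_cancel] at h2
    exact h2.trans (isBigO_const_const w one_ne_zero l)
  have hvw : (fun x => (K x)⁻¹ *ᵥ b - w) =O[l] h := by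
    refine IsBigO.congr' (Matrix.isBigO_mulVec hES hvb) (hv.mono fun x hx => hx.symm) ?_
    exact Eventually.of_forall fun x => by simp
  have hSQ : (fun x => Sig⁻¹ * Q x) =O[l] fun x => h x * h x := by
    simpa using (isBigO_const_const Sig⁻¹ (one_ne_zero (α := ℝ)) l).mul hQ
  have hQw : (fun x => (Sig⁻¹ * Q x) *ᵥ w) =O[l] fun x => h x * h x := by
    simpa using Matrix.isBigO_mulVec hSQ (isBigO_const_const w (one_ne_zero (α := ℝ)) l)
  refine (hQw.add (Matrix.isBigO_mulVec hES hvw)).congr' ?_ EventuallyEq.rfl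
  filter_upwards [hv, hKQ] with x hx hx2
  rw [mulVec_sub, ← hx, hx2]
  simp only [← mulVec_mulVec, add_mulVec, sum_mulVec, smul_mulVec, mulVec_add, mulVec_sum,
    mulVec_smul, hAw, zero_add]
  abel

/-- If `h → 0`, `Δ = ∑ aᵢ Aᵢ + P + o(h²)` with `P = O(h²)` and `K` is as in
`Matrix.inv_mulVec_expansion`, then `Δ K⁻¹ b` is `P w` plus the quadratic terms in the
coefficients that are not `o(h)`, up to `o(h²)`. -/
theorem Matrix.mulVec_inv_mulVec_expansion [Fintype ι] {h : X → ℝ} (hh : Tendsto h l (𝓝 0))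
    {Sig : Matrix (Fin d) (Fin d) ℝ} (hSig : IsUnit Sig)
    {K Q Δ P ρ : X → Matrix (Fin d) (Fin d) ℝ} (hK : ∀ᶠ x in l, IsUnit (K x))
    {A : ι → Matrix (Fin d) (Fin d) ℝ} {a c : ι → X → ℝ} (ha : ∀ i, a i =O[l] h)
    (hc : ∀ i, c i =O[l] h) {F : Finset ι} (haF : ∀ i ∉ F, a i =o[l] h)
    (hcF : ∀ i ∉ F, c i =o[l] h)
    (hKQ : ∀ᶠ x in l, Sig - K x = ∑ i, c i x • (A i + (A i)ᵀ) + Q x)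
    (hQ : Q =O[l] fun x => h x * h x)
    (hΔ : ∀ᶠ x in l, Δ x = ∑ i, a i x • A i + P x + ρ x)
    (hP : P =O[l] fun x => h x * h x) (hρ : ρ =o[l] fun x => h x * h x)
    {b w : Fin d → ℝ} (hw : w = Sig⁻¹ *ᵥ b) (hAw : ∀ i, A i *ᵥ w = 0) :
    (fun x => Δ x *ᵥ ((K x)⁻¹ *ᵥ b) - (P x *ᵥ w
      + ∑ i ∈ F, ∑ j ∈ F, (c j x * a i x) • ((A i * Sig⁻¹ * (A j)ᵀ) *ᵥ w)))
      =o[l] fun x => h x * h x := by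
  classical
  have hh1 : h =o[l] fun _ => (1 : ℝ) := (isLittleO_one_iff ℝ).2 hh
  have hhh : (fun x => h x * h x) =O[l] h := by
    simpa using (isBigO_refl h l).mul hh1.isBigO
  have hr := Matrix.inv_mulVec_expansion hh hSig hK hc hKQ hQ hw hAw
  set r := fun x => (K x)⁻¹ *ᵥ b - w - ∑ j, c j x • (Sig⁻¹ *ᵥ ((A j)ᵀ *ᵥ w)) with hrdef
  have hΔO : Δ =O[l] h :=
    (((IsBigO.fun_sum fun i _ => (ha i).smul_const_matrix _).add (hP.trans hhh)).add
      (hρ.isBigO.trans hhh)).congr' (hΔ.mono fun x hx => hx.symm) EventuallyEq.rfl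
  have hΔr : (fun x => Δ x *ᵥ r x) =o[l] fun x => h x * h x := by
    simpa using Matrix.isLittleO_mulVec (hΔO.trans_isLittleO hh1) hr
  have hρw : (fun x => ρ x *ᵥ w) =o[l] fun x => h x * h x := by
    simpa using Matrix.isLittleO_mulVec hρ (isBigO_const_const w (one_ne_zero (α := ℝ)) l)
  have hu : (fun x => ∑ j, c j x • (Sig⁻¹ *ᵥ ((A j)ᵀ *ᵥ w))) =O[l] h :=
    IsBigO.fun_sum fun j _ => (hc j).smul_const_vec _
  have hPu : (fun x => (P x + ρ x) *ᵥ ∑ j, c j x • (Sig⁻¹ *ᵥ ((A j)ᵀ *ᵥ w)))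
      =o[l] fun x => h x * h x := by
    have h1 := Matrix.isBigO_mulVec (hP.add hρ.isBigO) hu
    refine h1.trans_isLittleO ?_
    simpa using (isBigO_refl (fun x => h x * h x) l).mul_isLittleO hh1
  have hq : ∀ i j, ¬ (i ∈ F ∧ j ∈ F) → (fun x => c j x * a i x) =o[l] fun x => h x * h x := by
    intro i j hij
    by_cases hi : i ∈ F
    · exact (hcF j fun hj => hij ⟨hi, hj⟩).mul_isBigO (ha i)
    · exact (hc j).mul_isLittleO (haF i hi)
  have hrest : (fun x => ∑ i, ∑ j, (if i ∈ F ∧ j ∈ F then 0 else c j x * a i x) •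
      ((A i * Sig⁻¹ * (A j)ᵀ) *ᵥ w)) =o[l] fun x => h x * h x := by
    refine IsLittleO.fun_sum fun i _ => IsLittleO.fun_sum fun j _ => IsLittleO.smul_const_vec ?_ _
    by_cases hij : i ∈ F ∧ j ∈ F
    · simp [hij]
    · simpa [hij] using hq i j hij
  refine (((hΔr.add hρw).add hPu).add hrest).congr' ?_ EventuallyEq.rfl
  filter_upwards [hΔ] with x hx
  have hsplit : ∑ i, ∑ j, (c j x * a i x) • ((A i * Sig⁻¹ * (A j)ᵀ) *ᵥ w)
      = ∑ i, ∑ j, (if i ∈ F ∧ j ∈ F then 0 else c j x * a i x) •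
          ((A i * Sig⁻¹ * (A j)ᵀ) *ᵥ w)
        + ∑ i ∈ F, ∑ j ∈ F, (c j x * a i x) • ((A i * Sig⁻¹ * (A j)ᵀ) *ᵥ w) := by
    have hF : ∑ i ∈ F, ∑ j ∈ F, (c j x * a i x) • ((A i * Sig⁻¹ * (A j)ᵀ) *ᵥ w)
        = ∑ i, ∑ j, if i ∈ F ∧ j ∈ F then
            (c j x * a i x) • ((A i * Sig⁻¹ * (A j)ᵀ) *ᵥ w) else 0 := by
      simp [ite_and, Finset.sum_ite_irrel]
    rw [hF]
    simp only [← Finset.sum_add_distrib]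
    refine Finset.sum_congr rfl fun i _ => Finset.sum_congr rfl fun j _ => ?_
    split_ifs <;> simp
  have hAu : (∑ i, a i x • A i) *ᵥ (∑ j, c j x • (Sig⁻¹ *ᵥ ((A j)ᵀ *ᵥ w)))
      = ∑ i, ∑ j, (c j x * a i x) • ((A i * Sig⁻¹ * (A j)ᵀ) *ᵥ w) := by
    simp only [sum_mulVec, smul_mulVec, mulVec_sum, mulVec_smul, ← mulVec_mulVec,
      Finset.smul_sum, smul_smul]
    exact Finset.sum_comm
  have hAw' : (∑ i, a i x • A i) *ᵥ w = 0 := by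
    simp [sum_mulVec, smul_mulVec, hAw]
  have hv : (K x)⁻¹ *ᵥ b = w + ∑ j, c j x • (Sig⁻¹ *ᵥ ((A j)ᵀ *ᵥ w)) + r x := by
    simp only [hrdef]; abel
  have hΔu : Δ x *ᵥ ((K x)⁻¹ *ᵥ b) = Δ x *ᵥ r x + P x *ᵥ w + ρ x *ᵥ w
      + (P x + ρ x) *ᵥ (∑ j, c j x • (Sig⁻¹ *ᵥ ((A j)ᵀ *ᵥ w)))
      + ∑ i, ∑ j, (c j x * a i x) • ((A i * Sig⁻¹ * (A j)ᵀ) *ᵥ w) := by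
    rw [hv, mulVec_add, mulVec_add, ← hAu, hx]
    simp only [add_mulVec, hAw']
    abel
  rw [hΔu, hsplit]
  abel

end MatrixAsymptotics

section RpowAsymptotics

variable {X : Type*} {l : Filter X}

theorem Asymptotics.IsBigO.rpow_half_of_mul_self {y h : X → ℝ} {β : ℝ} (hy : ∀ᶠ x in l, 0 ≤ y x)
    (hh : ∀ x, 0 ≤ h x) (hyO : (fun x => y x ^ β) =O[l] fun x => h x * h x) :
    (fun x => y x ^ (β / 2)) =O[l] h := by
  refine (hyO.rpow (r := 1 / 2) (by norm_num)
    (Eventually.of_forall fun x => mul_nonneg (hh x) (hh x))).congr' ?_ ?_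
  · filter_upwards [hy] with x hx
    rw [← Real.rpow_mul hx, mul_one_div]
  · exact Eventually.of_forall fun x => by
      simp only [← Real.sqrt_eq_rpow, Real.sqrt_mul_self (hh x)]

theorem Asymptotics.IsBigO.rpow_isLittleO_of_half_lt {y h : X → ℝ} {β β' : ℝ}
    (hy : ∀ᶠ x in l, 0 ≤ y x) (hy0 : Tendsto y l (𝓝 0)) (hβ : 0 ≤ β) (hββ' : β / 2 < β')
    (hyO : (fun x => y x ^ (β / 2)) =O[l] h) : (fun x => y x ^ β') =o[l] h := by
  have h1 : (fun x => y x ^ (β' - β / 2)) =o[l] fun _ => (1 : ℝ) := by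
    refine (isLittleO_one_iff ℝ).2 ?_
    have hpos : 0 < β' - β / 2 := sub_pos.2 hββ'
    have := ((Real.continuous_rpow_const hpos.le).tendsto 0).comp hy0
    simpa [Function.comp_def, Real.zero_rpow hpos.ne'] using this
  refine (hyO.mul_isLittleO h1).congr' ?_ (Eventually.of_forall fun x => mul_one _)
  filter_upwards [hy] with x hx
  rw [← Real.rpow_add_of_nonneg hx (by positivity) (sub_pos.2 hββ').le, add_sub_cancel]

theorem Real.add_rpow_le_two_rpow_mul {x y p : ℝ} (hx : 0 ≤ x) (hy : 0 ≤ y) (hp : 0 ≤ p) :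
    (x + y) ^ p ≤ 2 ^ p * (x ^ p + y ^ p) := by
  wlog hxy : x ≤ y generalizing x y
  · simpa only [add_comm] using this hy hx (le_of_not_ge hxy)
  calc (x + y) ^ p ≤ (2 * y) ^ p := Real.rpow_le_rpow (by positivity) (by linarith) hp
    _ = 2 ^ p * y ^ p := Real.mul_rpow (by norm_num) hy
    _ ≤ 2 ^ p * (x ^ p + y ^ p) := by
      gcongr
      exact le_add_of_nonneg_left (Real.rpow_nonneg hx p)

end RpowAsymptotics

theorem Smat_zero {d : ℕ} {a : ℝ} (ha : a ≠ 0) (V : Matrix (Fin d) (Fin d) ℝ) :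
    Smat a V 0 = 0 := by
  simp [Smat, Real.zero_rpow ha]

attribute [local instance] Matrix.linftyOpNormedRing Matrix.linftyOpNormedAlgebra


/-- Expansion of the conditional mean
`d_τ(t) = [I − R(τ+t,τ)Σ(τ)⁻¹]b` under the kernel expansion hypotheses (A2):
`d_τ(t) = Σᵢ[A_{2,i}((τᵢ+tᵢ)^{βᵢ} − τᵢ^{βᵢ}) + S_{αᵢ,A_{5,i}}(tᵢ)]w
+ Σ_{i,j∈F} τⱼ^{βⱼ/2}((τᵢ+tᵢ)^{βᵢ/2} − τᵢ^{βᵢ/2})D_{i,j}w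
+ o(Σᵢ[τᵢ^{βᵢ} + tᵢ^{βᵢ} + |tᵢ|^{αᵢ}])` as `(τ,t) ↓ (0,0)`. -/
theorem stmt_13 {d n : ℕ} (hd : 1 ≤ d) (hn : 1 ≤ n)
    (R : (Fin n → ℝ) → (Fin n → ℝ) → Matrix (Fin d) (Fin d) ℝ)
    (hRsymm : ∀ t s, R t s = (R s t)ᵀ)
    (Sig : Matrix (Fin d) (Fin d) ℝ) (hSig0 : Sig = R 0 0)
    (δinv : ℝ) (hδinv : 0 < δinv)
    (hinv : ∀ t : Fin n → ℝ, (∀ i, 0 ≤ t i ∧ t i < δinv) → IsUnit (R t t))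
    (β' β α : Fin n → ℝ) (hβ'pos : ∀ i, 0 < β' i)
    (hββ' : ∀ i, β' i < β i ∧ β i ≤ 2 * β' i)
    (hα : ∀ i, 0 < α i ∧ α i < 2)
    (F : Finset (Fin n)) (hF : ∀ i, i ∈ F ↔ 2 * β' i = β i)
    (A1 A2 A5 : Fin n → Matrix (Fin d) (Fin d) ℝ)
    (A6 : Fin n → Fin n → Matrix (Fin d) (Fin d) ℝ)
    (hker : ∀ ε > (0 : ℝ), ∃ δ > (0 : ℝ), ∀ t s : Fin n → ℝ,
      (∀ i, 0 ≤ t i ∧ t i < δ) → (∀ i, 0 ≤ s i ∧ s i < δ) → ∀ p q : Fin d,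
        |(Sig - R t s
            - (∑ i, ((t i ^ β' i) • A1 i + (t i ^ β i) • A2 i
                 + (s i ^ β' i) • (A1 i)ᵀ + (s i ^ β i) • (A2 i)ᵀ
                 + Smat (α i) (A5 i) (t i - s i))
               + ∑ i ∈ F, ∑ j ∈ F, (t i ^ (β i / 2) * s j ^ (β j / 2)) • A6 i j)
            : Matrix (Fin d) (Fin d) ℝ) p q|
          ≤ ε * ∑ i, (t i ^ β i + s i ^ β i + |t i - s i| ^ α i))
    (b w : Fin d → ℝ) (hw : w = Sig⁻¹ *ᵥ b)
    (hA1w : ∀ i, A1 i *ᵥ w = 0)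
    (Dm : Fin n → Fin n → Matrix (Fin d) (Fin d) ℝ)
    (hD : ∀ i j, Dm i j = A6 i j + A1 i * Sig⁻¹ * (A1 j)ᵀ) :
    ∀ ε > (0 : ℝ), ∃ δ > (0 : ℝ), ∀ τ t : Fin n → ℝ,
      (∀ i, 0 ≤ τ i ∧ τ i < δ) → (∀ i, 0 ≤ t i ∧ t i < δ) → ∀ p : Fin d,
        |(((1 : Matrix (Fin d) (Fin d) ℝ) - R (τ + t) τ * (R τ τ)⁻¹) *ᵥ b
            - ((∑ i, (((((τ i + t i) ^ β i - τ i ^ β i) • A2 i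
                  + Smat (α i) (A5 i) (t i)) : Matrix (Fin d) (Fin d) ℝ) *ᵥ w))
               + ∑ i ∈ F, ∑ j ∈ F,
                   (τ j ^ (β j / 2) * ((τ i + t i) ^ (β i / 2) - τ i ^ (β i / 2))) •
                     (Dm i j *ᵥ w))) p|
          ≤ ε * ∑ i, (τ i ^ β i + t i ^ β i + |t i| ^ α i) := by
  have hSig : IsUnit Sig := hSig0 ▸ hinv 0 fun i => ⟨le_rfl, hδinv⟩
  have hβ : ∀ i, 0 < β i := fun i => (hβ'pos i).trans (hββ' i).1
  let S : Set ((Fin n → ℝ) × (Fin n → ℝ)) := {x | ∀ i, 0 ≤ x.1 i ∧ 0 ≤ x.2 i}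
  let l : Filter ((Fin n → ℝ) × (Fin n → ℝ)) := 𝓝[S] 0
  have hS : ∀ᶠ x in l, ∀ i, 0 ≤ x.1 i ∧ 0 ≤ x.2 i := self_mem_nhdsWithin
  have hlim {f : (Fin n → ℝ) × (Fin n → ℝ) → Fin n → ℝ} (hf : Continuous f) (h0 : f 0 = 0) :
      Tendsto f l (𝓝 0) := by
    have := hf.tendsto 0
    rw [h0] at this
    exact this.mono_left nhdsWithin_le_nhds
  have hlim1 : Tendsto (fun x : (Fin n → ℝ) × (Fin n → ℝ) => x.1) l (𝓝 0) :=
    hlim continuous_fst rfl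
  have hlim2 : Tendsto (fun x : (Fin n → ℝ) × (Fin n → ℝ) => x.1 + x.2) l (𝓝 0) :=
    hlim (by fun_prop) (by simp)
  let G : (Fin n → ℝ) × (Fin n → ℝ) → ℝ := fun x =>
    ∑ i, (x.1 i ^ β i + x.2 i ^ β i + |x.2 i| ^ α i)
  have hGl : Tendsto G l (𝓝 0) := by
    have hc : Continuous G := by
      refine continuous_finsetSum _ fun i _ => ((?_ : Continuous _).add ?_).add ?_
      · exact (Real.continuous_rpow_const (hβ i).le).comp (by fun_prop)
      · exact (Real.continuous_rpow_const (hβ i).le).comp (by fun_prop)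
      · exact (Real.continuous_rpow_const (hα i).1.le).comp (by fun_prop)
    have h0 : G 0 = 0 := by
      simp [G, Real.zero_rpow (hβ _).ne', Real.zero_rpow (hα _).1.ne']
    have := hc.tendsto 0
    rw [h0] at this
    exact this.mono_left nhdsWithin_le_nhds
  let h : (Fin n → ℝ) × (Fin n → ℝ) → ℝ := fun x => √(G x)
  have hh0 : ∀ x, 0 ≤ h x := fun x => Real.sqrt_nonneg _
  have hhl : Tendsto h l (𝓝 0) := by
    simpa [h, Function.comp_def] using (Real.continuous_sqrt.tendsto 0).comp hGl
  have hterm : ∀ᶠ x in l, ∀ i, 0 ≤ x.1 i ^ β i ∧ 0 ≤ x.2 i ^ β i ∧ 0 ≤ |x.2 i| ^ α i := by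
    filter_upwards [hS] with x hx i
    exact ⟨Real.rpow_nonneg (hx i).1 _, Real.rpow_nonneg (hx i).2 _,
      Real.rpow_nonneg (abs_nonneg _) _⟩
  have hG0 : ∀ᶠ x in l, 0 ≤ G x := by
    filter_upwards [hterm] with x hx
    exact Finset.sum_nonneg fun i _ => by linarith [hx i]
  have hhG : (fun x => h x * h x) =ᶠ[l] G := by
    filter_upwards [hG0] with x hx
    exact Real.mul_self_sqrt hx
  have hle : ∀ᶠ x in l, ∀ i, x.1 i ^ β i + x.2 i ^ β i + |x.2 i| ^ α i ≤ G x := by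
    filter_upwards [hterm] with x hx i
    exact Finset.single_le_sum (f := fun i => x.1 i ^ β i + x.2 i ^ β i + |x.2 i| ^ α i)
      (fun j _ => by linarith [hx j]) (Finset.mem_univ i)
  have hτO : ∀ i, (fun x : (Fin n → ℝ) × (Fin n → ℝ) => x.1 i ^ β i) =O[l]
      fun x => h x * h x := by
    intro i
    refine IsBigO.trans_eventuallyEq (IsBigO.of_bound 1 ?_) hhG.symm
    filter_upwards [hterm, hle, hG0] with x h1 h2 h3
    rw [Real.norm_of_nonneg (h1 i).1, Real.norm_of_nonneg h3]
    linarith [h1 i, h2 i]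
  have hαO : ∀ i, (fun x : (Fin n → ℝ) × (Fin n → ℝ) => |x.2 i| ^ α i) =O[l]
      fun x => h x * h x := by
    intro i
    refine IsBigO.trans_eventuallyEq (IsBigO.of_bound 1 ?_) hhG.symm
    filter_upwards [hterm, hle, hG0] with x h1 h2 h3
    rw [Real.norm_of_nonneg (h1 i).2.2, Real.norm_of_nonneg h3]
    linarith [h1 i, h2 i]
  have hσO : ∀ i, (fun x : (Fin n → ℝ) × (Fin n → ℝ) => (x.1 i + x.2 i) ^ β i) =O[l]
      fun x => h x * h x := by
    intro i
    refine IsBigO.trans_eventuallyEq (IsBigO.of_bound (2 ^ β i) ?_) hhG.symm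
    filter_upwards [hterm, hle, hG0, hS] with x h1 h2 h3 h4
    rw [Real.norm_of_nonneg (Real.rpow_nonneg (add_nonneg (h4 i).1 (h4 i).2) _),
      Real.norm_of_nonneg h3]
    refine (Real.add_rpow_le_two_rpow_mul (h4 i).1 (h4 i).2 (hβ i).le).trans ?_
    gcongr
    linarith [h1 i, h2 i]
  have hτ0 : ∀ i, ∀ᶠ x in l, 0 ≤ x.1 i := fun i => hS.mono fun x hx => (hx i).1
  have hσ0 : ∀ i, ∀ᶠ x in l, 0 ≤ x.1 i + x.2 i :=
    fun i => hS.mono fun x hx => add_nonneg (hx i).1 (hx i).2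
  have hτhalf := fun i => (hτO i).rpow_half_of_mul_self (hτ0 i) hh0
  have hσhalf := fun i => (hσO i).rpow_half_of_mul_self (hσ0 i) hh0
  have hFhalf : ∀ i ∈ F, β i / 2 = β' i := fun i hi => by linarith [(hF i).1 hi]
  have hFlt : ∀ i ∉ F, β i / 2 < β' i := fun i hi => by
    have h1 := (hββ' i).2
    have h2 : β i ≠ 2 * β' i := fun h3 => hi ((hF i).2 h3.symm)
    linarith [lt_of_le_of_ne h1 h2]
  have hcF : ∀ i ∉ F, (fun x : (Fin n → ℝ) × (Fin n → ℝ) => x.1 i ^ β' i) =o[l] h :=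
    fun i hi => (hτhalf i).rpow_isLittleO_of_half_lt (hτ0 i)
      (tendsto_pi_nhds.1 hlim1 i) (hβ i).le (hFlt i hi)
  have hdF : ∀ i ∉ F, (fun x : (Fin n → ℝ) × (Fin n → ℝ) => (x.1 i + x.2 i) ^ β' i) =o[l] h :=
    fun i hi => (hσhalf i).rpow_isLittleO_of_half_lt (hσ0 i)
      (tendsto_pi_nhds.1 hlim2 i) (hβ i).le (hFlt i hi)
  have hc : ∀ i, (fun x : (Fin n → ℝ) × (Fin n → ℝ) => x.1 i ^ β' i) =O[l] h := fun i => by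
    by_cases hi : i ∈ F
    · simpa only [hFhalf i hi] using hτhalf i
    · exact (hcF i hi).isBigO
  have hd' : ∀ i, (fun x : (Fin n → ℝ) × (Fin n → ℝ) => (x.1 i + x.2 i) ^ β' i) =O[l] h :=
    fun i => by
      by_cases hi : i ∈ F
      · simpa only [hFhalf i hi] using hσhalf i
      · exact (hdF i hi).isBigO
  let rem : (Fin n → ℝ) → (Fin n → ℝ) → Matrix (Fin d) (Fin d) ℝ := fun t s => Sig - R t s
    - (∑ i, ((t i ^ β' i) • A1 i + (t i ^ β i) • A2 i
        + (s i ^ β' i) • (A1 i)ᵀ + (s i ^ β i) • (A2 i)ᵀ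
        + Smat (α i) (A5 i) (t i - s i))
      + ∑ i ∈ F, ∑ j ∈ F, (t i ^ (β i / 2) * s j ^ (β j / 2)) • A6 i j)
  have hsmall : ∀ {f : (Fin n → ℝ) × (Fin n → ℝ) → Fin n → ℝ}, Tendsto f l (𝓝 0) →
      ∀ δ > 0, ∀ᶠ x in l, ∀ i, f x i < δ := by
    intro f hf δ hδ
    exact eventually_all.2 fun i => (tendsto_pi_nhds.1 hf i).eventually_lt_const hδ
  have hrem : ∀ f : (Fin n → ℝ) × (Fin n → ℝ) → Fin n → ℝ, Tendsto f l (𝓝 0) →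
      (∀ i, ∀ᶠ x in l, 0 ≤ f x i) →
      ((fun x => ∑ i, (f x i ^ β i + x.1 i ^ β i + |f x i - x.1 i| ^ α i)) =O[l]
        fun x => h x * h x) →
      (fun x => rem (f x) x.1) =o[l] fun x => h x * h x := by
    intro f hf hf0 hfO
    refine IsLittleO.trans_isBigO (Matrix.isLittleO_of_entries fun p q => ?_) hfO
    refine isLittleO_iff.2 fun ε hε => ?_
    obtain ⟨δ, hδ, hk⟩ := hker ε hε
    filter_upwards [hsmall hf δ hδ, hsmall hlim1 δ hδ, hS, eventually_all.2 hf0] with x h1 h2 h3 h4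
    exact (hk (f x) x.1 (fun i => ⟨h4 i, h1 i⟩) (fun i => ⟨(h3 i).1, h2 i⟩) p q).trans
      (mul_le_mul_of_nonneg_left (le_abs_self _) hε.le)
  have hremτ : (fun x : (Fin n → ℝ) × (Fin n → ℝ) => rem x.1 x.1) =o[l] fun x => h x * h x := by
    refine hrem _ hlim1 hτ0 (IsBigO.fun_sum fun i _ => ?_)
    simpa [Real.zero_rpow (hα i).1.ne'] using (hτO i).add (hτO i)
  have hremσ : (fun x : (Fin n → ℝ) × (Fin n → ℝ) => rem (x.1 + x.2) x.1) =o[l]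
      fun x => h x * h x := by
    refine hrem _ hlim2 hσ0 (IsBigO.fun_sum fun i _ => ?_)
    simpa using ((hσO i).add (hτO i)).add (hαO i)
  have hK : ∀ᶠ x : (Fin n → ℝ) × (Fin n → ℝ) in l, IsUnit (R x.1 x.1) := by
    filter_upwards [hsmall hlim1 δinv hδinv, hS] with x h1 h2
    exact hinv _ fun i => ⟨(h2 i).1, h1 i⟩
  let Q : (Fin n → ℝ) × (Fin n → ℝ) → Matrix (Fin d) (Fin d) ℝ := fun x =>
    ∑ i, (x.1 i ^ β i) • (A2 i + (A2 i)ᵀ)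
      + ∑ i ∈ F, ∑ j ∈ F, (x.1 i ^ (β i / 2) * x.1 j ^ (β j / 2)) • A6 i j + rem x.1 x.1
  let P : (Fin n → ℝ) × (Fin n → ℝ) → Matrix (Fin d) (Fin d) ℝ := fun x =>
    ∑ i, (((x.1 i + x.2 i) ^ β i - x.1 i ^ β i) • A2 i + Smat (α i) (A5 i) (x.2 i))
      + ∑ i ∈ F, ∑ j ∈ F, (x.1 j ^ (β j / 2) *
          ((x.1 i + x.2 i) ^ (β i / 2) - x.1 i ^ (β i / 2))) • A6 i j
  have hQ : Q =O[l] fun x => h x * h x := by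
    refine ((IsBigO.fun_sum fun i _ => (hτO i).smul_const_matrix _).add
      (IsBigO.fun_sum fun i _ => IsBigO.fun_sum fun j _ => ?_)).add hremτ.isBigO
    exact ((hτhalf i).mul (hτhalf j)).smul_const_matrix _
  have hP : P =O[l] fun x => h x * h x := by
    refine (IsBigO.fun_sum fun i _ =>
      (((hσO i).sub (hτO i)).smul_const_matrix _).add ?_).add
      (IsBigO.fun_sum fun i _ => IsBigO.fun_sum fun j _ => ?_)
    · refine ((hαO i).smul_const_matrix (A5 i)).congr' ?_ EventuallyEq.rfl
      filter_upwards [hS] with x hx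
      simp [Smat, (hx i).2]
    · exact ((hτhalf j).mul ((hσhalf i).sub (hτhalf i))).smul_const_matrix _
  have hKQ : ∀ x : (Fin n → ℝ) × (Fin n → ℝ), Sig - R x.1 x.1
      = ∑ i, (x.1 i ^ β' i) • (A1 i + (A1 i)ᵀ) + Q x := by
    intro x
    simp only [Q, rem, sub_self, Smat_zero (hα _).1.ne', smul_add, Finset.sum_add_distrib,
      Finset.sum_const_zero]
    abel
  have hA6 : ∀ (x : (Fin n → ℝ) × (Fin n → ℝ)) i j, (x.1 j ^ (β j / 2) *
      ((x.1 i + x.2 i) ^ (β i / 2) - x.1 i ^ (β i / 2))) • A6 i j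
      = ((x.1 i + x.2 i) ^ (β i / 2) * x.1 j ^ (β j / 2)) • A6 i j
        - (x.1 i ^ (β i / 2) * x.1 j ^ (β j / 2)) • A6 i j := by
    intro x i j
    rw [← sub_smul]
    congr 1
    ring
  have hΔ : ∀ x : (Fin n → ℝ) × (Fin n → ℝ), R x.1 x.1 - R (x.1 + x.2) x.1
      = ∑ i, ((x.1 i + x.2 i) ^ β' i - x.1 i ^ β' i) • A1 i + P x
        + (rem (x.1 + x.2) x.1 - rem x.1 x.1) := by
    intro x
    simp only [P, rem, hA6, sub_self, Pi.add_apply, add_sub_cancel_left,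
      Smat_zero (hα _).1.ne', sub_smul, Finset.sum_add_distrib, Finset.sum_sub_distrib,
      Finset.sum_const_zero]
    abel
  have hmain := Matrix.mulVec_inv_mulVec_expansion hhl hSig hK
    (fun i => (hd' i).sub (hc i)) hc (fun i hi => (hdF i hi).sub (hcF i hi)) hcF
    (Eventually.of_forall hKQ) hQ (Eventually.of_forall hΔ) hP (hremσ.sub hremτ) hw hA1w
  replace hmain := hmain.trans_isBigO hhG.isBigO
  intro ε hε
  have hev := (isLittleO_iff.1 hmain hε).and (hK.and hG0)
  obtain ⟨δ, hδ, hball⟩ := Metric.mem_nhdsWithin_iff.1 hev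
  refine ⟨δ, hδ, fun τ t hτ ht p => ?_⟩
  have hmem : (τ, t) ∈ Metric.ball (0 : (Fin n → ℝ) × (Fin n → ℝ)) δ ∩ S := by
    refine ⟨?_, fun i => ⟨(hτ i).1, (ht i).1⟩⟩
    rw [mem_ball_zero_iff, Prod.norm_mk, max_lt_iff, pi_norm_lt_iff hδ, pi_norm_lt_iff hδ]
    exact ⟨fun i => by simpa [abs_of_nonneg (hτ i).1] using (hτ i).2,
      fun i => by simpa [abs_of_nonneg (ht i).1] using (ht i).2⟩
  obtain ⟨hb, hu, hg⟩ := hball hmem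
  rw [Real.norm_of_nonneg hg] at hb
  refine le_trans (le_of_eq ?_) ((norm_le_pi_norm _ p).trans hb)
  rw [Real.norm_eq_abs]
  have hvec : ((1 : Matrix (Fin d) (Fin d) ℝ) - R (τ + t) τ * (R τ τ)⁻¹) *ᵥ b
      = (R τ τ - R (τ + t) τ) *ᵥ ((R τ τ)⁻¹ *ᵥ b) := by
    rw [mulVec_mulVec, sub_mul, Matrix.mul_nonsing_inv _ ((Matrix.isUnit_iff_isUnit_det _).1 hu)]
  have hDsum : ∑ i ∈ F, ∑ j ∈ F,
        (τ j ^ (β j / 2) * ((τ i + t i) ^ (β i / 2) - τ i ^ (β i / 2))) • (Dm i j *ᵥ w)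
      = (∑ i ∈ F, ∑ j ∈ F, (τ j ^ (β j / 2) *
          ((τ i + t i) ^ (β i / 2) - τ i ^ (β i / 2))) • A6 i j) *ᵥ w
        + ∑ i ∈ F, ∑ j ∈ F, (τ j ^ β' j * ((τ i + t i) ^ β' i - τ i ^ β' i)) •
          ((A1 i * Sig⁻¹ * (A1 j)ᵀ) *ᵥ w) := by
    simp only [sum_mulVec, ← Finset.sum_add_distrib]
    refine Finset.sum_congr rfl fun i hi => Finset.sum_congr rfl fun j hj => ?_
    rw [hD, add_mulVec, smul_add, smul_mulVec, hFhalf i hi, hFhalf j hj]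
  congr 2
  rw [hvec, hDsum, ← sum_mulVec, ← add_assoc, ← add_mulVec]
end

section
/- Let d, k ≥ 1, Λ > 0 in ℝ^k, w ∈ ℝ^d with all components positive, C₀ > 0 and γ ∈ (0,2]^k. There exist ε₀ > 0 and constants C, c > 0, depending only on d, k, Λ, w, C₀, γ, such that the following holds for every 0 < ε ≤ ε₀, every G ∈ ℝ and every σ² > 0: if (χ_x)_{x∈ℝ^d} is a family of ℝ^d-valued Gaussian random fields on [0,Λ] = Πₘ[0,Λₘ] ⊂ ℝ^k with a.s. continuous sample paths, measurable in x, satisfying (i) E[|χ_x(t) − χ_x(s)|²] ≤ C₀·Σ_{m=1}^k |t_m − s_m|^{γ_m} for all t, s ∈ [0,Λ] and all x; (ii) sup_{F⊆{1,…,d}} sup_{t∈[0,Λ]} Σ_{j∈F} w_j·E[χ_{x,j}(t)] ≤ G + ε·Σ_{j=1}^d |x_j| for all x; and (iii) sup_{F⊆{1,…,d}} sup_{t∈[0,Λ]} Var(Σ_{j∈F} w_j·χ_{x,j}(t)) ≤ σ² for all x; then ∫_{ℝ^d} e^{wᵀx}·P{∃ t ∈ [0,Λ] : χ_x(t) > x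 (componentwise)} dx ≤ C·e^{c(G + σ²)}. -/
open MeasureTheory ProbabilityTheory Real

/-- Chernoff bound for the upper tail of a real Gaussian random variable. -/
theorem measureReal_lt_le_of_hasGaussianLaw {Ω : Type*} {mΩ : MeasurableSpace Ω} {P : Measure Ω}
    {X : Ω → ℝ} (hX : HasGaussianLaw X P) (a : ℝ) {l : ℝ} (hl : 0 ≤ l) :
    P.real {ω | a < X ω} ≤ exp (-l * a + l * P[X] + l ^ 2 * Var[X; P] / 2) := by
  have := hX.isProbabilityMeasure
  have hmap := hX.map_eq_gaussianReal
  have hmgf := mgf_gaussianReal hmap l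
  have hint : Integrable (fun ω => exp (l * X ω)) P := by
    rw [← mgf_pos_iff, hmgf]
    positivity
  calc P.real {ω | a < X ω} ≤ P.real {ω | a ≤ X ω} :=
        measureReal_mono fun ω (h : a < X ω) => h.le
    _ ≤ _ := measure_ge_le_exp_mul_mgf a hl hint
    _ = _ := by
        rw [hmgf, ← exp_add, Real.coe_toNNReal _ (variance_nonneg X P)]
        ring_nf

/-- If a value at dyadic level `n` exceeds `a + ∑ b`, then the initial value exceeds `a` or some
parent-child increment exceeds its threshold `b`. -/
theorem lt_or_exists_increment_lt {k : ℕ} (y : ℕ → (Fin k → ℕ) → ℝ) (a : ℝ) (b : ℕ → ℝ) (n : ℕ)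
    (i : Fin k → ℕ) (hi : ∀ m, i m < 2 ^ n) (h : a + ∑ l ∈ Finset.range n, b l < y n i) :
    a < y 0 0 ∨ ∃ l, ∃ j : Fin k → Fin (2 ^ (l + 1)),
      b l < y (l + 1) (fun m => j m) - y l (fun m => j m / 2) := by
  induction n generalizing i with
  | zero =>
    left
    have : i = 0 := by
      ext m
      simpa using hi m
    simpa [this] using h
  | succ n ih =>
    by_cases hb : b n < y (n + 1) i - y n (fun m => i m / 2)
    · exact Or.inr ⟨n, fun m => ⟨i m, hi m⟩, hb⟩
    · refine ih (fun m => i m / 2) (fun m => ?_) ?_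
      · have := hi m
        rw [pow_succ] at this
        omega
      · rw [Finset.sum_range_succ] at h
        linarith

theorem tail_exponent_le {q A e v p r c : ℝ} (hp : p = c * r) (hc : 0 < c) (hr : 0 < r)
    (hv : v + e ^ 2 ≤ A * r ^ 2) :
    -(2 / p) * (p * q) + 2 / p * e + (2 / p) ^ 2 * v / 2 ≤ -2 * q + (1 / 2 + 2 * A / c ^ 2) := by
  have hp0 : 0 < p := hp ▸ mul_pos hc hr
  have h1 : -(2 / p) * (p * q) = -2 * q := by field_simp
  have h2 : (2 / p) ^ 2 * (v + e ^ 2) / 2 ≤ 2 * A / c ^ 2 := by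
    calc (2 / p) ^ 2 * (v + e ^ 2) / 2 ≤ (2 / p) ^ 2 * (A * r ^ 2) / 2 := by gcongr
      _ = _ := by subst hp; field_simp
  nlinarith [sq_nonneg (2 / p * e - 1)]

/-- Dyadic chaining bound for the supremum of a Gaussian family indexed by the dyadic grids of a
cube: geometric decay of the second moments of parent-child increments gives an exponential tail. -/
theorem exists_dyadic_chaining_tail_bound {Ω : Type*} {mΩ : MeasurableSpace Ω} (P : Measure Ω)
    [IsProbabilityMeasure P] (k : ℕ) {r A : ℝ} (hr0 : 0 < r) (hr1 : r < 1) :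
    ∃ K > 0, ∀ Y : ℕ → (Fin k → ℕ) → Ω → ℝ, HasGaussianLaw (Y 0 0) P →
      (∀ n i, (∀ m, i m < 2 ^ (n + 1)) →
        HasGaussianLaw (fun ω => Y (n + 1) i ω - Y n (fun m => i m / 2) ω) P ∧
        ∫ ω, (Y (n + 1) i ω - Y n (fun m => i m / 2) ω) ^ 2 ∂P ≤ A * (r ^ n) ^ 2) →
      ∀ M s u : ℝ, 0 ≤ u → 0 ≤ M → 0 ≤ s → P[Y 0 0] ≤ M → Var[Y 0 0; P] ≤ s →
        P.real {ω | ∃ n i, (∀ m, i m < 2 ^ n) ∧ u < Y n i ω} ≤ K * exp (-2 * u + 4 * M + 8 * s) := by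
  set c : ℝ := (1 - r) / 2 with hc
  have hc0 : 0 < c := by linarith
  set L : ℝ := (k + 1) * log 2 / 2 with hL
  have hL0 : 0 ≤ L := by positivity
  set E : ℝ := exp (1 / 2 + 2 * A / c ^ 2) with hE
  have hsum : Summable fun n : ℕ => c * r ^ n * ((n + 1) * L) := by
    have h1 := summable_pow_mul_geometric_of_norm_lt_one (R := ℝ) 1 (r := r)
      (by rwa [Real.norm_of_nonneg hr0.le])
    have h2 := summable_geometric_of_lt_one hr0.le hr1
    refine ((h1.add h2).mul_left (c * L)).congr fun n => ?_
    ring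
  set Q : ℝ := ∑' n : ℕ, c * r ^ n * ((n + 1) * L) with hQ
  refine ⟨exp (4 * Q) + E, by positivity, fun Y hY0 hY M s u hu hM hs hmean hvar => ?_⟩
  set b : ℕ → ℝ := fun n => c * r ^ n * (u + (n + 1) * L) with hb
  have hbsum (n : ℕ) : ∑ l ∈ Finset.range n, b l ≤ u / 2 + Q := by
    have h1 : ∑ l ∈ Finset.range n, c * r ^ l * u ≤ u / 2 := by
      rw [← Finset.sum_mul, ← Finset.mul_sum]
      have : ∑ l ∈ Finset.range n, r ^ l ≤ (1 - r)⁻¹ := by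
        rw [← tsum_geometric_of_lt_one hr0.le hr1]
        exact (summable_geometric_of_lt_one hr0.le hr1).sum_le_tsum _ fun i _ => by positivity
      calc c * (∑ l ∈ Finset.range n, r ^ l) * u ≤ c * (1 - r)⁻¹ * u := by gcongr
        _ = u / 2 := by
          have : 1 - r ≠ 0 := by linarith
          rw [hc]; field_simp
    have h2 : ∑ l ∈ Finset.range n, c * r ^ l * ((l + 1) * L) ≤ Q :=
      hsum.sum_le_tsum _ fun i _ => by positivity
    calc ∑ l ∈ Finset.range n, b l
        = ∑ l ∈ Finset.range n, (c * r ^ l * u + c * r ^ l * ((l + 1) * L)) := by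
          simp only [hb, mul_add]
      _ ≤ _ := by rw [Finset.sum_add_distrib]; linarith
  have hsub : {ω | ∃ n i, (∀ m, i m < 2 ^ n) ∧ u < Y n i ω} ⊆
      {ω | u / 2 - Q < Y 0 0 ω} ∪ ⋃ l : ℕ, ⋃ j : Fin k → Fin (2 ^ (l + 1)),
        {ω | b l < Y (l + 1) (fun m => j m) ω - Y l (fun m => j m / 2) ω} := by
    rintro ω ⟨n, i, hi, h⟩
    have := lt_or_exists_increment_lt (fun n i => Y n i ω) (u / 2 - Q) b n i hi
      (by linarith [hbsum n])
    simpa using this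
  have h0 : P {ω | u / 2 - Q < Y 0 0 ω} ≤
      ENNReal.ofReal (exp (4 * Q) * exp (-2 * u + 4 * M + 8 * s)) := by
    rw [← ofReal_measureReal]
    refine ENNReal.ofReal_le_ofReal
      ((measureReal_lt_le_of_hasGaussianLaw hY0 _ (l := 4) (by norm_num)).trans ?_)
    rw [← exp_add]
    exact exp_le_exp.2 (by linarith)
  have hinc (l : ℕ) (j : Fin k → Fin (2 ^ (l + 1))) :
      P {ω | b l < Y (l + 1) (fun m => j m) ω - Y l (fun m => j m / 2) ω} ≤
        ENNReal.ofReal (exp (-2 * u) * E * exp (-((l + 1) * ((k + 1) * log 2)))) := by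
    obtain ⟨hG, hm⟩ := hY l (fun m => j m) (fun m => (j m).2)
    rw [← ofReal_measureReal]
    refine ENNReal.ofReal_le_ofReal
      ((measureReal_lt_le_of_hasGaussianLaw hG _ (l := 2 / (c * r ^ l)) (by positivity)).trans ?_)
    rw [hE, ← exp_add, ← exp_add]
    refine exp_le_exp.2 ((tail_exponent_le rfl hc0 (pow_pos hr0 l) (A := A) ?_).trans ?_)
    · have := variance_eq_sub hG.memLp_two
      simp only [Pi.pow_apply] at this
      linarith
    · rw [hL]; linarith
  have hlev (l : ℕ) : P (⋃ j : Fin k → Fin (2 ^ (l + 1)),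
      {ω | b l < Y (l + 1) (fun m => j m) ω - Y l (fun m => j m / 2) ω}) ≤
        ENNReal.ofReal (exp (-2 * u) * E * (1 / 2 * (1 / 2) ^ l)) := by
    refine (measure_iUnion_fintype_le _ _).trans ((Finset.sum_le_sum fun j _ => hinc l j).trans ?_)
    rw [Finset.sum_const, nsmul_eq_mul, ← ENNReal.ofReal_natCast,
      ← ENNReal.ofReal_mul (by positivity)]
    refine ENNReal.ofReal_le_ofReal (le_of_eq ?_)
    have : exp (-((l + 1) * ((k + 1) * log 2))) = ((2 : ℝ) ^ ((l + 1) * (k + 1)))⁻¹ := by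
      rw [exp_neg, show ((l : ℝ) + 1) * ((k + 1) * log 2) = ((l + 1) * (k + 1) : ℕ) * log 2 by
        push_cast; ring, exp_nat_mul, exp_log two_pos]
    rw [this]
    simp only [Finset.card_univ, Fintype.card_pi, Fintype.card_fin, Finset.prod_const,
      Nat.cast_pow, Nat.cast_ofNat]
    rw [mul_add (l + 1) k 1, pow_add 2 ((l + 1) * k), ← pow_mul, one_div_pow]
    field_simp
    ring
  have hgeo : ∑' l : ℕ, exp (-2 * u) * E * (1 / 2 * (1 / 2 : ℝ) ^ l) = exp (-2 * u) * E := by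
    rw [tsum_mul_left, tsum_mul_left, tsum_geometric_two]
    norm_num
  have hunion : P (⋃ l : ℕ, ⋃ j : Fin k → Fin (2 ^ (l + 1)),
      {ω | b l < Y (l + 1) (fun m => j m) ω - Y l (fun m => j m / 2) ω}) ≤
        ENNReal.ofReal (E * exp (-2 * u + 4 * M + 8 * s)) := by
    refine (measure_iUnion_le _).trans ((ENNReal.tsum_le_tsum hlev).trans ?_)
    rw [← ENNReal.ofReal_tsum_of_nonneg (fun l => by positivity)
      ((summable_geometric_two.mul_left _).mul_left _), hgeo, mul_comm]
    refine ENNReal.ofReal_le_ofReal (mul_le_mul_of_nonneg_left ?_ (by positivity))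
    exact exp_le_exp.2 (by linarith)
  refine ENNReal.toReal_le_of_le_ofReal (by positivity) ((measure_mono hsub).trans
    ((measure_union_le _ _).trans ((add_le_add h0 hunion).trans ?_)))
  rw [← ENNReal.ofReal_add (by positivity) (by positivity), add_mul]

/-- The point with index `i` in the level-`n` dyadic grid of the box `[0, Λ]`. -/
noncomputable def dyadicPoint {k : ℕ} (Λ : Fin k → ℝ) (n : ℕ) (i : Fin k → ℕ) : Fin k → ℝ :=
  fun m => Λ m * i m / 2 ^ n

theorem dyadicPoint_mem_Icc {k : ℕ} {Λ : Fin k → ℝ} (hΛ : ∀ m, 0 < Λ m) {n : ℕ} {i : Fin k → ℕ}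
    (hi : ∀ m, i m < 2 ^ n) : dyadicPoint Λ n i ∈ Set.Icc 0 Λ := by
  refine ⟨fun m => ?_, fun m => ?_⟩
  · have := hΛ m
    simp only [dyadicPoint, Pi.zero_apply]
    positivity
  · have h : (i m : ℝ) ≤ 2 ^ n := by exact_mod_cast (hi m).le
    simp only [dyadicPoint]
    rw [div_le_iff₀ (by positivity)]
    exact mul_le_mul_of_nonneg_left h (hΛ m).le

theorem exists_dyadicPoint_mem {k : ℕ} {Λ : Fin k → ℝ} (hΛ : ∀ m, 0 < Λ m) {t : Fin k → ℝ}
    (ht : t ∈ Set.Icc 0 Λ) {S : Set (Fin k → ℝ)} (hS : S ∈ nhdsWithin t (Set.Icc 0 Λ)) :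
    ∃ n i, (∀ m, i m < 2 ^ n) ∧ dyadicPoint Λ n i ∈ S := by
  set i : ℕ → Fin k → ℕ := fun n m => min ⌊t m / Λ m * 2 ^ n⌋₊ (2 ^ n - 1) with hi
  have hlt (n : ℕ) (m : Fin k) : i n m < 2 ^ n := by
    have : 0 < 2 ^ n := by positivity
    simp only [hi]
    omega
  have hbd (n : ℕ) (m : Fin k) : |(i n m : ℝ) - t m / Λ m * 2 ^ n| ≤ 1 := by
    have h0 : 0 ≤ t m / Λ m * 2 ^ n := by
      have := ht.1 m
      have := hΛ m
      simp only [Pi.zero_apply] at *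
      positivity
    have h1 : t m / Λ m * 2 ^ n ≤ 2 ^ n :=
      mul_le_of_le_one_left (by positivity) ((div_le_one (hΛ m)).2 (ht.2 m))
    have h2 := Nat.floor_le h0
    have h3 := Nat.lt_floor_add_one (t m / Λ m * 2 ^ n)
    have h4 : ((2 ^ n - 1 : ℕ) : ℝ) = 2 ^ n - 1 := by
      rw [Nat.cast_sub Nat.one_le_two_pow]; simp
    rw [abs_le]
    simp only [hi, Nat.cast_min, h4]
    rcases min_cases (⌊t m / Λ m * 2 ^ n⌋₊ : ℝ) (2 ^ n - 1) with h | h <;>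
      constructor <;> linarith
  have hlim : Filter.Tendsto (fun n => dyadicPoint Λ n (i n)) Filter.atTop (nhds t) := by
    refine tendsto_pi_nhds.2 fun m => ?_
    have hz : Filter.Tendsto (fun n : ℕ => Λ m * (1 / 2 : ℝ) ^ n) Filter.atTop (nhds 0) := by
      simpa using (tendsto_pow_atTop_nhds_zero_of_lt_one (r := (1 / 2 : ℝ)) (by norm_num)
        (by norm_num)).const_mul (Λ m)
    refine tendsto_iff_dist_tendsto_zero.2 (squeeze_zero (fun _ => dist_nonneg) (fun n => ?_) hz)
    have hm := hΛ m
    have : dyadicPoint Λ n (i n) m - t m =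
        Λ m * (1 / 2) ^ n * ((i n m : ℝ) - t m / Λ m * 2 ^ n) := by
      simp only [dyadicPoint]
      rw [one_div_pow]
      field_simp
    rw [Real.dist_eq, this, abs_mul, abs_of_pos (by positivity)]
    exact mul_le_of_le_one_right (by positivity) (hbd n m)
  have hlim' := tendsto_nhdsWithin_iff.2
    ⟨hlim, Filter.Eventually.of_forall fun n => dyadicPoint_mem_Icc hΛ (hlt n)⟩
  obtain ⟨n, hn⟩ := (hlim'.eventually hS).exists
  exact ⟨n, i n, hlt n, hn⟩

theorem abs_dyadicPoint_sub_parent_le {k : ℕ} {Λ : Fin k → ℝ} (hΛ : ∀ m, 0 < Λ m) (n : ℕ)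
    (i : Fin k → ℕ) (m : Fin k) :
    |dyadicPoint Λ (n + 1) i m - dyadicPoint Λ n (fun m => i m / 2) m| ≤ Λ m * (1 / 2) ^ n := by
  have hm := hΛ m
  have h : (i m : ℝ) = 2 * (i m / 2 : ℕ) + (i m % 2 : ℕ) := by
    exact_mod_cast (Nat.div_add_mod (i m) 2).symm
  have h2 : ((i m % 2 : ℕ) : ℝ) ≤ 1 := by
    exact_mod_cast Nat.le_of_lt_succ (Nat.mod_lt (i m) two_pos)
  have : dyadicPoint Λ (n + 1) i m - dyadicPoint Λ n (fun m => i m / 2) m =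
      Λ m * (1 / 2) ^ n * ((i m % 2 : ℕ) / 2) := by
    simp only [dyadicPoint]
    rw [h, one_div_pow, pow_succ]
    field_simp
    ring
  rw [this, abs_of_nonneg (by positivity)]
  exact mul_le_of_le_one_right (by positivity) (by linarith)

/-- Exponential tail of the supremum over a box of a continuous real Gaussian field whose
increments satisfy a Hölder bound in mean square. -/
theorem exists_tail_bound_of_holder {Ω : Type*} {mΩ : MeasurableSpace Ω} (P : Measure Ω)
    [IsProbabilityMeasure P] {k : ℕ} (hk : 1 ≤ k) {Λ : Fin k → ℝ} (hΛ : ∀ m, 0 < Λ m)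
    {γ : Fin k → ℝ} (hγ : ∀ m, 0 < γ m) {B : ℝ} (hB : 0 ≤ B) :
    ∃ K > 0, ∀ Z : (Fin k → ℝ) → Ω → ℝ, HasGaussianLaw (Z 0) P →
      (∀ᵐ ω ∂P, ContinuousOn (fun t => Z t ω) (Set.Icc 0 Λ)) →
      (∀ t ∈ Set.Icc 0 Λ, ∀ s ∈ Set.Icc 0 Λ, HasGaussianLaw (fun ω => Z t ω - Z s ω) P ∧
        ∫ ω, (Z t ω - Z s ω) ^ 2 ∂P ≤ B * ∑ m, |t m - s m| ^ γ m) →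
      ∀ M s u : ℝ, 0 ≤ u → 0 ≤ M → 0 ≤ s → P[Z 0] ≤ M → Var[Z 0; P] ≤ s →
        P.real {ω | ∃ t ∈ Set.Icc 0 Λ, u < Z t ω} ≤ K * exp (-2 * u + 4 * M + 8 * s) := by
  have : Nonempty (Fin k) := ⟨⟨0, hk⟩⟩
  obtain ⟨m₀, hm₀⟩ := Finite.exists_min γ
  set g := γ m₀ with hg
  have hg0 : 0 < g := hγ m₀
  set r : ℝ := (1 / 2) ^ (g / 2) with hr
  have hr0 : 0 < r := by positivity
  have hr1 : r < 1 := rpow_lt_one (by norm_num) (by norm_num) (by positivity)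
  have hrn (n : ℕ) : (r ^ n) ^ 2 = ((1 / 2 : ℝ) ^ n) ^ g := by
    rw [← pow_mul, hr, ← rpow_natCast, ← rpow_mul (by norm_num), ← rpow_natCast,
      ← rpow_mul (by norm_num)]
    congr 1
    push_cast
    ring
  obtain ⟨K, hK, h⟩ := exists_dyadic_chaining_tail_bound P k (r := r)
    (A := B * ∑ m, Λ m ^ γ m) hr0 hr1
  refine ⟨K, hK, fun Z hZ0 hcont hZ M s u hu hM hs hmean hvar => ?_⟩
  have hzero : dyadicPoint Λ 0 0 = 0 := by
    ext m
    simp [dyadicPoint]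
  have key := h (fun n i => Z (dyadicPoint Λ n i)) (by simpa only [hzero] using hZ0)
    (fun n i hi => ?_) M s u hu hM hs (by simpa only [hzero] using hmean)
    (by simpa only [hzero] using hvar)
  · refine le_trans (ENNReal.toReal_mono (measure_ne_top _ _) (measure_mono_ae ?_)) key
    filter_upwards [hcont] with ω hω
    rintro ⟨t, ht, hut⟩
    obtain ⟨n, i, hi, hS⟩ := exists_dyadicPoint_mem hΛ ht ((hω t ht).eventually_const_lt hut)
    exact ⟨n, i, hi, hS⟩
  · have hi' : ∀ m, i m / 2 < 2 ^ n := fun m => by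
      have := hi m
      rw [pow_succ] at this
      omega
    obtain ⟨hG, hm⟩ := hZ _ (dyadicPoint_mem_Icc hΛ hi) _ (dyadicPoint_mem_Icc hΛ hi')
    refine ⟨hG, hm.trans ?_⟩
    rw [mul_assoc, Finset.sum_mul]
    refine mul_le_mul_of_nonneg_left (Finset.sum_le_sum fun m _ => ?_) hB
    have hm := hΛ m
    calc _ ≤ (Λ m * (1 / 2) ^ n) ^ γ m :=
          rpow_le_rpow (abs_nonneg _) (abs_dyadicPoint_sub_parent_le hΛ n i m) (hγ m).le
      _ = Λ m ^ γ m * ((1 / 2 : ℝ) ^ n) ^ γ m := mul_rpow hm.le (by positivity)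
      _ ≤ Λ m ^ γ m * (r ^ n) ^ 2 := by
          rw [hrn]
          exact mul_le_mul_of_nonneg_left (rpow_le_rpow_of_exponent_ge (by positivity)
            (pow_le_one₀ (by norm_num) (by norm_num)) (hm₀ m)) (by positivity)

theorem integrable_exp_neg_mul_sum_abs {d : ℕ} {δ : ℝ} (hδ : 0 < δ) :
    Integrable fun x : Fin d → ℝ => exp (-δ * ∑ j, |x j|) := by
  have h1 : Integrable fun y : ℝ => exp (-δ * |y|) := by
    rw [← integrableOn_univ, ← Set.Iic_union_Ioi (a := (0 : ℝ))]
    refine IntegrableOn.union ?_ ?_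
    · refine (integrableOn_exp_mul_Iic hδ 0).congr_fun (fun y hy => ?_) measurableSet_Iic
      rw [abs_of_nonpos hy]
      ring_nf
    · refine (integrableOn_exp_mul_Ioi (neg_lt_zero.2 hδ) 0).congr_fun (fun y hy => ?_)
        measurableSet_Ioi
      rw [abs_of_pos hy]
  have h2 := Integrable.fintype_prod (ι := Fin d) (μ := fun _ => (volume : Measure ℝ))
    (f := fun _ y => exp (-δ * |y|)) fun _ => h1
  refine h2.congr (Filter.Eventually.of_forall fun x => ?_)
  simp only [Finset.mul_sum, exp_sum]

/-- Mean-square bound for the increment of a weighted sum of coordinates. -/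
theorem integral_sq_sum_mul_le {Ω : Type*} {mΩ : MeasurableSpace Ω} {P : Measure Ω} {d : ℕ}
    (w : Fin d → ℝ) (F : Finset (Fin d)) {D : Ω → Fin d → ℝ}
    (hD : ∀ j, MemLp (fun ω => D ω j) 2 P) :
    ∫ ω, (∑ j ∈ F, w j * D ω j) ^ 2 ∂P ≤ (∑ j, w j ^ 2) * ∫ ω, ∑ j, D ω j ^ 2 ∂P := by
  rw [← integral_const_mul]
  refine integral_mono_of_nonneg (Filter.Eventually.of_forall fun ω => sq_nonneg _)
    ((integrable_finsetSum _ fun j _ => (hD j).integrable_sq).const_mul _)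
    (Filter.Eventually.of_forall fun ω => ?_)
  refine (Finset.sum_mul_sq_le_sq_mul_sq F w (D ω)).trans ?_
  exact mul_le_mul
    (Finset.sum_le_univ_sum_of_nonneg fun j => sq_nonneg _)
    (Finset.sum_le_univ_sum_of_nonneg fun j => sq_nonneg _)
    (Finset.sum_nonneg fun j _ => sq_nonneg _) (Finset.sum_nonneg fun j _ => sq_nonneg _)

/-- integral estimate. There exist `ε₀ > 0` and constants `C, c > 0`,
depending only on `d, k, Λ, w, C₀, γ`, such that for every `0 < ε ≤ ε₀`, every `G ∈ ℝ`,
`σ² > 0`, and every family `(χ_x)` of `ℝ^d`-valued Gaussian fields on `[0,Λ] ⊂ ℝ^k` with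
a.s. continuous paths, measurable in `x`, satisfying the Hölder bound (i), the mean bound (ii)
and the variance bound (iii), one has
`∫ e^{wᵀx} P{∃ t ∈ [0,Λ] : χ_x(t) > x} dx ≤ C e^{c(G+σ²)}`. -/
theorem stmt_18 {d k : ℕ} (hd : 1 ≤ d) (hk : 1 ≤ k)
    (Λ : Fin k → ℝ) (hΛ : ∀ m, 0 < Λ m)
    (w : Fin d → ℝ) (hw : ∀ j, 0 < w j)
    (C₀ : ℝ) (hC₀ : 0 < C₀)
    (γ : Fin k → ℝ) (hγ : ∀ m, 0 < γ m ∧ γ m ≤ 2)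
    {Ω : Type*} [MeasureSpace Ω] [IsProbabilityMeasure (ℙ : Measure Ω)] :
    ∃ ε₀ > (0 : ℝ), ∃ C > (0 : ℝ), ∃ c > (0 : ℝ),
      ∀ ε : ℝ, 0 < ε → ε ≤ ε₀ → ∀ G : ℝ, ∀ σ2 : ℝ, 0 < σ2 →
      ∀ χ : (Fin d → ℝ) → (Fin k → ℝ) → Ω → (Fin d → ℝ),
        (∀ t, Measurable fun p : (Fin d → ℝ) × Ω => χ p.1 t p.2) →
        (∀ x, ∀ᵐ ω ∂ℙ, ContinuousOn (fun t => χ x t ω) (Set.Icc 0 Λ)) →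
        (∀ (x : Fin d → ℝ) (m : ℕ) (ts : Fin m → (Fin k → ℝ)) (l : Fin m → Fin d → ℝ),
          ∃ (μ : ℝ) (v : NNReal),
            Measure.map (fun ω => ∑ i, ∑ j, l i j * χ x (ts i) ω j) ℙ = gaussianReal μ v) →
        (∀ (x : Fin d → ℝ) (t s : Fin k → ℝ), t ∈ Set.Icc 0 Λ → s ∈ Set.Icc 0 Λ →
          (∫ ω, ∑ j, (χ x t ω j - χ x s ω j) ^ 2) ≤ C₀ * ∑ m, |t m - s m| ^ γ m) →
        (∀ (x : Fin d → ℝ) (F : Finset (Fin d)) (t : Fin k → ℝ), t ∈ Set.Icc 0 Λ →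
          ∑ j ∈ F, w j * ∫ ω, χ x t ω j ≤ G + ε * ∑ j, |x j|) →
        (∀ (x : Fin d → ℝ) (F : Finset (Fin d)) (t : Fin k → ℝ), t ∈ Set.Icc 0 Λ →
          (∫ ω, (∑ j ∈ F, w j * χ x t ω j) ^ 2)
            - (∫ ω, ∑ j ∈ F, w j * χ x t ω j) ^ 2 ≤ σ2) →
        ∫ x : Fin d → ℝ,
            Real.exp (∑ j, w j * x j) *
              (ℙ {ω | ∃ t ∈ Set.Icc 0 Λ, ∀ j, x j < χ x t ω j}).toReal
          ≤ C * Real.exp (c * (G + σ2)) := by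
  have : Nonempty (Fin d) := ⟨⟨0, hd⟩⟩
  obtain ⟨j₀, hj₀⟩ := Finite.exists_min w
  have hw₀ := hw j₀
  obtain ⟨K, hK, hmain⟩ := exists_tail_bound_of_holder (ℙ : Measure Ω) hk hΛ
    (fun m => (hγ m).1) (B := (∑ j, w j ^ 2) * C₀) (by positivity)
  set I : ℝ := ∫ x : Fin d → ℝ, exp (-(w j₀ / 2) * ∑ j, |x j|) with hI
  have hI0 : 0 ≤ I := integral_nonneg fun x => (exp_pos _).le
  refine ⟨w j₀ / 8, by positivity, (K + 1) * (I + 1), by positivity, 8, by norm_num, ?_⟩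
  intro ε hε hε₀ G σ2 hσ χ hmeas hcont hgauss hhold hmean hvar
  have hG : 0 ≤ G := by simpa using hmean 0 ∅ 0 ⟨le_rfl, fun m => (hΛ m).le⟩
  have h0mem : (0 : Fin k → ℝ) ∈ Set.Icc 0 Λ := ⟨le_rfl, fun m => (hΛ m).le⟩
  have hlin (x : Fin d → ℝ) (n : ℕ) (ts : Fin n → Fin k → ℝ) (l : Fin n → Fin d → ℝ) :
      HasGaussianLaw (fun ω => ∑ i, ∑ j, l i j * χ x (ts i) ω j) (ℙ : Measure Ω) := by
    obtain ⟨μ, v, h⟩ := hgauss x n ts l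
    exact ⟨h ▸ inferInstance⟩
  have hsum (x : Fin d → ℝ) (t : Fin k → ℝ) (F : Finset (Fin d)) :
      HasGaussianLaw (fun ω => ∑ j ∈ F, w j * χ x t ω j) (ℙ : Measure Ω) := by
    simpa [Finset.sum_ite_mem, ite_mul] using
      hlin x 1 (fun _ => t) (fun _ j => if j ∈ F then w j else 0)
  have hinc (x : Fin d → ℝ) (t s : Fin k → ℝ) (F : Finset (Fin d)) :
      HasGaussianLaw (fun ω => ∑ j ∈ F, w j * χ x t ω j - ∑ j ∈ F, w j * χ x s ω j)
        (ℙ : Measure Ω) := by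
    simpa [Finset.sum_ite_mem, ite_mul, Fin.sum_univ_two, sub_eq_add_neg] using
      hlin x 2 ![t, s] ![fun j => if j ∈ F then w j else 0, fun j => if j ∈ F then -w j else 0]
  have hcoord (x : Fin d → ℝ) (t : Fin k → ℝ) (j : Fin d) :
      MemLp (fun ω => χ x t ω j) 2 (ℙ : Measure Ω) := by
    have := (hlin x 1 (fun _ => t) (fun _ => Pi.single j 1)).memLp_two
    simpa [Pi.single_apply, ite_mul] using this
  have hpt (x : Fin d → ℝ) : exp (∑ j, w j * x j) *
      (ℙ {ω | ∃ t ∈ Set.Icc 0 Λ, ∀ j, x j < χ x t ω j}).toReal ≤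
        (K + 1) * exp (8 * (G + σ2)) * exp (-(w j₀ / 2) * ∑ j, |x j|) := by
    set F : Finset (Fin d) := {j | 0 < x j} with hF
    set u : ℝ := ∑ j ∈ F, w j * x j with hu
    have hu0 : 0 ≤ u := Finset.sum_nonneg fun j hj =>
      mul_nonneg (hw j).le (Finset.mem_filter.1 hj).2.le
    have hN : 0 ≤ ∑ j, |x j| := Finset.sum_nonneg fun j _ => abs_nonneg _
    set M : ℝ := G + ε * ∑ j, |x j| with hM
    have hM0 : 0 ≤ M := by positivity
    have hprob : (ℙ {ω | ∃ t ∈ Set.Icc 0 Λ, ∀ j, x j < χ x t ω j}).toReal ≤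
        (K + 1) * exp (-2 * u + 4 * M + 8 * σ2) := by
      by_cases hne : F.Nonempty
      · have hEZ : ∫ ω, ∑ j ∈ F, w j * χ x 0 ω j = ∑ j ∈ F, w j * ∫ ω, χ x 0 ω j := by
          rw [integral_finsetSum _ fun j _ =>
            ((hcoord x 0 j).integrable one_le_two).const_mul _]
          simp only [integral_const_mul]
        have key := hmain (fun t ω => ∑ j ∈ F, w j * χ x t ω j) (hsum x 0 F) ?_ ?_ M σ2 u hu0 hM0
          hσ.le (hEZ.trans_le (hmean x F 0 h0mem)) ?_
        · refine (ENNReal.toReal_mono (measure_ne_top _ _) (measure_mono ?_)).trans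
            (key.trans (mul_le_mul_of_nonneg_right (by linarith) (exp_pos _).le))
          rintro ω ⟨t, ht, h⟩
          exact ⟨t, ht, Finset.sum_lt_sum_of_nonempty hne fun j _ =>
            mul_lt_mul_of_pos_left (h j) (hw j)⟩
        · filter_upwards [hcont x] with ω hω
          exact continuousOn_finsetSum _ fun j _ =>
            continuousOn_const.mul (continuousOn_pi.1 hω j)
        · refine fun t ht s hs => ⟨hinc x t s F, ?_⟩
          simp only [← Finset.sum_sub_distrib, ← mul_sub]
          refine (integral_sq_sum_mul_le w F (D := fun ω j => χ x t ω j - χ x s ω j)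
            fun j => (hcoord x t j).sub (hcoord x s j)).trans ?_
          rw [mul_assoc]
          exact mul_le_mul_of_nonneg_left (hhold x t s ht hs)
            (Finset.sum_nonneg fun j _ => sq_nonneg _)
        · rw [variance_eq_sub (hsum x 0 F).memLp_two]
          simpa only [Pi.pow_apply] using hvar x F 0 h0mem
      · have hu' : u = 0 := by simp [hu, Finset.not_nonempty_iff_eq_empty.1 hne]
        refine measureReal_le_one.trans ?_
        have : 1 ≤ exp (-2 * u + 4 * M + 8 * σ2) := one_le_exp (by linarith)
        nlinarith
    have hexp : ∑ j, w j * x j - 2 * u ≤ -w j₀ * ∑ j, |x j| := by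
      rw [hu, hF, Finset.sum_filter, Finset.mul_sum, Finset.mul_sum, ← Finset.sum_sub_distrib]
      refine Finset.sum_le_sum fun j _ => ?_
      have := mul_le_mul_of_nonneg_right (hj₀ j) (abs_nonneg (x j))
      split_ifs with hj
      · rw [abs_of_pos hj] at *
        linarith
      · rw [abs_of_nonpos (not_lt.1 hj)] at *
        linarith
    calc _ ≤ exp (∑ j, w j * x j) * ((K + 1) * exp (-2 * u + 4 * M + 8 * σ2)) := by gcongr
      _ = (K + 1) * exp (∑ j, w j * x j + (-2 * u + 4 * M + 8 * σ2)) := by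
          rw [exp_add (∑ j, w j * x j)]
          ring
      _ ≤ (K + 1) * exp (8 * (G + σ2) + -(w j₀ / 2) * ∑ j, |x j|) := by
          have := mul_le_mul_of_nonneg_right hε₀ hN
          refine mul_le_mul_of_nonneg_left (exp_le_exp.2 ?_) (by linarith)
          rw [hM]
          linarith
      _ = _ := by rw [exp_add]; ring
  calc _ ≤ ∫ x : Fin d → ℝ, (K + 1) * exp (8 * (G + σ2)) * exp (-(w j₀ / 2) * ∑ j, |x j|) :=
        integral_mono_of_nonneg (Filter.Eventually.of_forall fun x => by positivity)
          ((integrable_exp_neg_mul_sum_abs (by positivity)).const_mul _)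
          (Filter.Eventually.of_forall hpt)
    _ = (K + 1) * exp (8 * (G + σ2)) * I := integral_const_mul _ _
    _ ≤ (K + 1) * exp (8 * (G + σ2)) * (I + 1) := by gcongr; linarith
    _ = _ := by ring
end
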